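/- Let Ω and Ω̃ be Jordan domains in ℂ, let A = Ω \ ⋃_{i=1}^n closure(B_i) and Ã be relative circle domains in Ω and Ω̃ respectively, and let g : closure(A) → closure(Ã) be a homeomorphism that is holomorphic with nonvanishing derivative on A, maps ∂Ω onto ∂Ω̃, and maps each peripheral circle of A onto a peripheral circle of Ã. Let p ∈ A, and let a, b, c, d ∈ ℂ satisfy ad − bc = 1 and cp + d ≠ 0, and suppose the Möbius transformation m(z) = (az + b)/(cz + d) satisfies m(p) = g(p), m'(p) = g'(p) and m''(p) = g''(p). Then there exist z, w ∈ ∂Ω with cw + d ≠ 0 and g(z) = (aw + b)/(cw + d); that is, g(∂Ω) ∩ m(∂Ω) ≠ ∅. -/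

import Mathlib

open Set Metric MeasureTheory Filter
open scoped NNReal ENNReal Topology

noncomputable section

/-- A (nonempty, open, connected) domain in the complex plane. -/
def IsPlaneDomain (Ω : Set ℂ) : Prop := IsOpen Ω ∧ IsConnected Ω

/-- A family of open round discs (given by centers `c` and radii `r`) whose closures
are contained in `Ω` and are pairwise disjoint. -/
def IsSchottkyFamily {I : Type*} (Ω : Set ℂ) (c : I → ℂ) (r : I → ℝ) : Prop :=
  (∀ i, 0 < r i) ∧ (∀ i, closedBall (c i) (r i) ⊆ Ω) ∧
    Pairwise fun i j => Disjoint (closedBall (c i) (r i)) (closedBall (c j) (r j))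

/-- `S` is a relative Schottky set in the domain `Ω`. -/
def IsRelativeSchottkySet (Ω S : Set ℂ) : Prop :=
  IsPlaneDomain Ω ∧
    ∃ (I : Type) (c : I → ℂ) (r : I → ℝ),
      IsSchottkyFamily Ω c r ∧ S = Ω \ ⋃ i, ball (c i) (r i)

/-- A Jordan domain: a bounded domain whose boundary is an embedded circle, and which is
a connected component of the complement of its boundary. -/
def IsJordanDomain (Ω : Set ℂ) : Prop :=
  IsPlaneDomain Ω ∧ Bornology.IsBounded Ω ∧
    (∃ γ : ℂ → ℂ, ContinuousOn γ (sphere (0 : ℂ) 1) ∧ InjOn γ (sphere (0 : ℂ) 1) ∧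
      γ '' sphere (0 : ℂ) 1 = frontier Ω) ∧
    ∀ p ∈ Ω, connectedComponentIn (frontier Ω)ᶜ p = Ω

/-- `f : ℂ → ℂ` restricts to a homeomorphism from `S` onto `T`. -/
def IsHomeoOn (f : ℂ → ℂ) (S T : Set ℂ) : Prop :=
  ∃ e : S ≃ₜ T, ∀ z : S, (e z : ℂ) = f (z : ℂ)

/-- `f` is `η`-quasisymmetric on `X`. -/
def QuasisymmetricWith (η : ℝ≥0 ≃ₜ ℝ≥0) (f : ℂ → ℂ) (X : Set ℂ) : Prop :=
  ∀ p ∈ X, ∀ q ∈ X, ∀ s ∈ X, ∀ t : ℝ≥0,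
    dist p q ≤ (t : ℝ) * dist p s → dist (f p) (f q) ≤ (η t : ℝ) * dist (f p) (f s)

/-- `f` is locally quasisymmetric on `X`: its restriction to every compact subset of `X`
is quasisymmetric. -/
def LocallyQuasisymmetricOn (f : ℂ → ℂ) (X : Set ℂ) : Prop :=
  ∀ K ⊆ X, IsCompact K → ∃ η : ℝ≥0 ≃ₜ ℝ≥0, QuasisymmetricWith η f K

/-- `f` is locally bi-Lipschitz on `S`. -/
def LocallyBiLipschitzOn (f : ℂ → ℂ) (S : Set ℂ) : Prop :=
  ∀ p ∈ S, ∃ U ∈ 𝓝[S] p, ∃ L : ℝ, 1 ≤ L ∧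
    ∀ x ∈ U, ∀ y ∈ U,
      dist x y / L ≤ dist (f x) (f y) ∧ dist (f x) (f y) ≤ L * dist x y

/-- A continuous nonvanishing function on a contractible space has a continuous logarithm. -/
theorem exists_continuous_exp_eq {X : Type*} [TopologicalSpace X] [LocallyPathConnectedSpace X]
    [ContractibleSpace X] {f : X → ℂ} (hf : Continuous f) (h0 : ∀ x, f x ≠ 0) :
    ∃ h : X → ℂ, Continuous h ∧ ∀ x, f x = Complex.exp (h x) := by
  have hU : IsSimplyConnected (univ : Set X) := by
    exact (Homeomorph.Set.univ X).toHomotopyEquiv.simplyConnectedSpace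
  obtain ⟨h, hc, he⟩ := Complex.exists_continuousOn_eqOn_exp_comp hU isOpen_univ
    hf.continuousOn (by rintro ⟨x, -, hx⟩; exact h0 x hx)
  exact ⟨h, by rwa [← continuousOn_univ], fun x => (he (mem_univ x)).symm⟩

theorem tietze_complex {s : Set ℂ} (hs : IsClosed s) {h : ℂ → ℂ} (hh : ContinuousOn h s) :
    ∃ H : ℂ → ℂ, Continuous H ∧ EqOn H h s := by
  obtain ⟨H, hH⟩ := ContinuousMap.exists_restrict_eq hs
    (⟨s.domRestrict h, continuousOn_iff_continuous_domRestrict.mp hh⟩ : C(s, ℂ))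
  refine ⟨H, H.continuous, fun x hx => ?_⟩
  exact DFunLike.congr_fun hH ⟨x, hx⟩

/-- The function `φ` on `ℝ` has a continuous logarithm which grows by `2πik` over a period. -/
def LoopWind (φ : ℝ → ℂ) (k : ℤ) : Prop :=
  ∃ H : ℝ → ℂ, Continuous H ∧ (∀ s, φ s = Complex.exp (H s)) ∧
    ∀ s, H (s + 2 * Real.pi) = H s + 2 * Real.pi * k * Complex.I

/-- The function `F` has winding number `k` about the origin along the circle `sphere c r`. -/
def HasWind (F : ℂ → ℂ) (c : ℂ) (r : ℝ) (k : ℤ) : Prop :=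
  LoopWind (fun s => F (circleMap c r s)) k

/-- A continuous function with values in `2πiℤ` is constant. -/
theorem eq_of_exp_eq_one {X : Type*} [TopologicalSpace X] [PreconnectedSpace X] {f : X → ℂ}
    (hf : Continuous f) (h1 : ∀ x, Complex.exp (f x) = 1) :
    ∃ k : ℤ, ∀ x, f x = 2 * Real.pi * k * Complex.I := by
  have hk : ∀ x, ∃ k : ℤ, f x = 2 * Real.pi * k * Complex.I := fun x => by
    obtain ⟨k, hk⟩ := Complex.exp_eq_one_iff.mp (h1 x)
    exact ⟨k, by rw [hk]; ring⟩
  rcases isEmpty_or_nonempty X with hX | ⟨⟨x0⟩⟩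
  · exact ⟨0, fun x => (hX.false x).elim⟩
  choose k hk using hk
  have hpi : (2 * Real.pi : ℝ) ≠ 0 := by positivity
  have hkc : Continuous k := by
    rw [Int.isClosedEmbedding_coe_real.isEmbedding.continuous_iff]
    have : ((↑) : ℤ → ℝ) ∘ k = fun x => (f x).im / (2 * Real.pi) := by
      ext x
      rw [hk x, eq_div_iff hpi]
      simp [mul_comm]
    rw [this]
    fun_prop
  refine ⟨k x0, fun x => ?_⟩
  rw [hk x, PreconnectedSpace.constant ‹_› hkc (x := x) (y := x0)]

theorem LoopWind.exists {φ : ℝ → ℂ} (hc : Continuous φ) (h0 : ∀ s, φ s ≠ 0)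
    (hp : ∀ s, φ (s + 2 * Real.pi) = φ s) : ∃ k, LoopWind φ k := by
  obtain ⟨H, hH, he⟩ := exists_continuous_exp_eq hc h0
  obtain ⟨k, hk⟩ := eq_of_exp_eq_one (f := fun s => H (s + 2 * Real.pi) - H s) (by fun_prop)
    (fun s => by rw [Complex.exp_sub, ← he, ← he, hp, div_self (h0 s)])
  exact ⟨k, H, hH, he, fun s => by rw [← hk s]; ring⟩

theorem LoopWind.mul {φ ψ : ℝ → ℂ} {k l : ℤ} (h1 : LoopWind φ k) (h2 : LoopWind ψ l) :
    LoopWind (fun s => φ s * ψ s) (k + l) := by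
  obtain ⟨H, hH, he, hp⟩ := h1
  obtain ⟨H', hH', he', hp'⟩ := h2
  refine ⟨fun s => H s + H' s, by fun_prop, fun s => by beta_reduce; rw [he, he', Complex.exp_add],
    fun s => ?_⟩
  beta_reduce
  rw [hp, hp']; push_cast; ring

theorem LoopWind.inv {φ : ℝ → ℂ} {k : ℤ} (h1 : LoopWind φ k) :
    LoopWind (fun s => (φ s)⁻¹) (-k) := by
  obtain ⟨H, hH, he, hp⟩ := h1
  refine ⟨fun s => - H s, by fun_prop, fun s => by beta_reduce; rw [he, Complex.exp_neg],
    fun s => ?_⟩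
  beta_reduce
  rw [hp]; push_cast; ring

theorem LoopWind.div {φ ψ : ℝ → ℂ} {k l : ℤ} (h1 : LoopWind φ k) (h2 : LoopWind ψ l) :
    LoopWind (fun s => φ s / ψ s) (k - l) := by
  simpa only [div_eq_mul_inv, sub_eq_add_neg] using h1.mul h2.inv

theorem LoopWind.zpow {φ : ℝ → ℂ} {k : ℤ} (h1 : LoopWind φ k) (n : ℤ) :
    LoopWind (fun s => φ s ^ n) (n * k) := by
  obtain ⟨H, hH, he, hp⟩ := h1
  refine ⟨fun s => n * H s, by fun_prop, fun s => by beta_reduce; rw [he, Complex.exp_int_mul],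
    fun s => ?_⟩
  beta_reduce
  rw [hp]; push_cast; ring

theorem LoopWind.congr {φ ψ : ℝ → ℂ} {k : ℤ} (h1 : LoopWind φ k) (h : ∀ s, φ s = ψ s) :
    LoopWind ψ k := by
  rwa [← funext h]

theorem LoopWind.unique {φ : ℝ → ℂ} {k l : ℤ} (h1 : LoopWind φ k) (h2 : LoopWind φ l) :
    k = l := by
  obtain ⟨H, hH, he, hp⟩ := h1
  obtain ⟨H', hH', he', hp'⟩ := h2
  obtain ⟨m, hm⟩ := eq_of_exp_eq_one (f := fun s => H s - H' s) (by fun_prop)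
    (fun s => by rw [Complex.exp_sub, ← he, ← he', he]; exact div_self (Complex.exp_ne_zero _))
  have h1 := hm (0 + 2 * Real.pi)
  rw [hp, hp', show H 0 + 2 * Real.pi * k * Complex.I - (H' 0 + 2 * Real.pi * l * Complex.I)
    = H 0 - H' 0 + 2 * Real.pi * Complex.I * (k - l) by ring, hm 0, add_eq_left] at h1
  have h2 : (2 * Real.pi * Complex.I : ℂ) ≠ 0 := Complex.two_pi_I_ne_zero
  have h3 := (mul_eq_zero.mp h1).resolve_left h2
  exact_mod_cast sub_eq_zero.mp h3

/-- The boundary loop of a homotopy to a constant has winding number zero. -/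
theorem LoopWind.of_homotopy {Γ : ℝ → ℝ → ℂ}
    (hc : ContinuousOn (fun x : ℝ × ℝ => Γ x.1 x.2) (Icc 0 1 ×ˢ univ))
    (h0 : ∀ t ∈ Icc (0 : ℝ) 1, ∀ s, Γ t s ≠ 0)
    (hp : ∀ t ∈ Icc (0 : ℝ) 1, ∀ s, Γ t (s + 2 * Real.pi) = Γ t s)
    (hz : ∀ s, Γ 0 s = Γ 0 0) : LoopWind (Γ 1) 0 := by
  set τ : ℝ → ℝ := fun t => (projIcc (0 : ℝ) 1 zero_le_one t : ℝ) with hτ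
  have hτm : ∀ t, τ t ∈ Icc (0 : ℝ) 1 := fun t => (projIcc (0 : ℝ) 1 zero_le_one t).2
  have hτc : Continuous τ := by fun_prop
  have hcc : Continuous (fun x : ℝ × ℝ => Γ (τ x.1) x.2) := by
    have := hc.comp_continuous (f := fun x : ℝ × ℝ => (τ x.1, x.2)) (by fun_prop)
      (fun x => ⟨hτm x.1, mem_univ _⟩)
    exact this
  obtain ⟨H, hH, he⟩ := exists_continuous_exp_eq hcc (fun x => h0 _ (hτm x.1) _)
  obtain ⟨k, hk⟩ := eq_of_exp_eq_one
    (f := fun x : ℝ × ℝ => H (x.1, x.2 + 2 * Real.pi) - H x) (by fun_prop)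
    (fun x => by
      rw [Complex.exp_sub, ← he, ← he]
      simp only
      rw [hp _ (hτm _), div_self (h0 _ (hτm _) _)])
  have t0 : τ 0 = 0 := by simp [hτ]
  have t1 : τ 1 = 1 := by simp [hτ]
  obtain ⟨m, hm⟩ := eq_of_exp_eq_one
    (f := fun s : ℝ => H (0, s) - H (0, 0)) (by fun_prop)
    (fun s => by
      rw [Complex.exp_sub, ← he, ← he]
      simp only [t0]
      rw [hz, div_self (h0 _ (by simp) _)])
  refine ⟨fun s => H (1, s), by fun_prop, fun s => ?_, fun s => ?_⟩
  · rw [← he]; simp only [t1]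
  · have h1 := hk (1, s)
    have h2 := hk (0, 0)
    have h3 := hm 0
    have h4 := hm (0 + 2 * Real.pi)
    simp only at h1 h2 h3 h4
    have : H (1, s + 2 * Real.pi) = H (1, s) + (H (0, 0 + 2 * Real.pi) - H (0,0)) := by
      rw [h2, ← h1]; ring
    beta_reduce
    rw [this, h4]; simp at h3 ⊢
    exact h3

theorem LoopWind.of_slitPlane {φ : ℝ → ℂ} (hc : Continuous φ) (h0 : ∀ s, φ s ∈ Complex.slitPlane)
    (hp : ∀ s, φ (s + 2 * Real.pi) = φ s) : LoopWind φ 0 :=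
  ⟨fun s => Complex.log (φ s), hc.clog h0,
    fun s => (Complex.exp_log (Complex.slitPlane_ne_zero (h0 s))).symm, fun s => by simp [hp]⟩

theorem circleMap_add_two_pi (c : ℂ) (r s : ℝ) :
    circleMap c r (s + 2 * Real.pi) = circleMap c r s := periodic_circleMap c r s

theorem HasWind.exists {F : ℂ → ℂ} {c : ℂ} {r : ℝ} (hr : 0 ≤ r) (hF : ContinuousOn F (sphere c r))
    (h0 : ∀ x ∈ sphere c r, F x ≠ 0) : ∃ k, HasWind F c r k :=
  LoopWind.exists (hF.comp_continuous (continuous_circleMap c r) (circleMap_mem_sphere c hr))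
    (fun s => h0 _ (circleMap_mem_sphere c hr s)) (fun s => by rw [circleMap_add_two_pi])

theorem HasWind.congr {F G : ℂ → ℂ} {c : ℂ} {r : ℝ} {k : ℤ} (hF : HasWind F c r k) (hr : 0 ≤ r)
    (h : ∀ x ∈ sphere c r, F x = G x) : HasWind G c r k :=
  LoopWind.congr hF fun s => h _ (circleMap_mem_sphere c hr s)

theorem HasWind.of_slitPlane {F : ℂ → ℂ} {c : ℂ} {r : ℝ} (hr : 0 ≤ r)
    (hF : ContinuousOn F (sphere c r))
    (h0 : ∀ x ∈ sphere c r, F x ∈ Complex.slitPlane) : HasWind F c r 0 :=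
  LoopWind.of_slitPlane
    (hF.comp_continuous (continuous_circleMap c r) (circleMap_mem_sphere c hr))
    (fun s => h0 _ (circleMap_mem_sphere c hr s)) (fun s => by rw [circleMap_add_two_pi])

/-- If `L` does not vanish on a closed disc containing the image under `g` of a circle, then
`L ∘ g` has winding number zero along the circle. -/
theorem HasWind.comp_closedBall {L g : ℂ → ℂ} {c c' : ℂ} {r r' : ℝ} (hr : 0 ≤ r)
    (hL : ContinuousOn L (closedBall c' r')) (h0 : ∀ x ∈ closedBall c' r', L x ≠ 0)
    (hg : ContinuousOn g (sphere c r)) (hm : ∀ x ∈ sphere c r, g x ∈ closedBall c' r') :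
    HasWind (fun x => L (g x)) c r 0 := by
  have hr' : c' ∈ closedBall c' r' := by
    have := hm _ (circleMap_mem_sphere c hr 0)
    exact mem_closedBall_self (dist_nonneg.trans (mem_closedBall.mp this))
  have key : ∀ t ∈ Icc (0 : ℝ) 1, ∀ s,
      c' + t * (g (circleMap c r s) - c') ∈ closedBall c' r' := by
    intro t ht s
    have h1 := hm _ (circleMap_mem_sphere c hr s)
    have := (convex_closedBall c' r').add_smul_sub_mem hr' h1 ht
    simpa using this
  have hgc : Continuous fun s => g (circleMap c r s) :=
    hg.comp_continuous (continuous_circleMap c r) (circleMap_mem_sphere c hr)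
  have := LoopWind.of_homotopy (Γ := fun t s => L (c' + t * (g (circleMap c r s) - c')))
    (hL.comp (f := fun x : ℝ × ℝ => c' + (x.1 : ℂ) * (g (circleMap c r x.2) - c'))
      (continuous_const.add ((Complex.continuous_ofReal.comp continuous_fst).mul
        ((hgc.comp continuous_snd).sub continuous_const))).continuousOn (fun x hx => key _ hx.1 _))
    (fun t ht s => h0 _ (key t ht s)) (fun t ht s => by rw [circleMap_add_two_pi])
    (fun s => by simp)
  exact this.congr fun s => by simp

theorem HasWind.of_closedBall {F : ℂ → ℂ} {c : ℂ} {r : ℝ} (hr : 0 ≤ r)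
    (hF : ContinuousOn F (closedBall c r)) (h0 : ∀ x ∈ closedBall c r, F x ≠ 0) :
    HasWind F c r 0 :=
  HasWind.comp_closedBall (g := id) hr hF h0 continuousOn_id
    fun _ hx => sphere_subset_closedBall hx

theorem HasWind.mul {F G : ℂ → ℂ} {c : ℂ} {r : ℝ} {k l : ℤ} (h1 : HasWind F c r k)
    (h2 : HasWind G c r l) : HasWind (fun x => F x * G x) c r (k + l) := LoopWind.mul h1 h2

theorem HasWind.div {F G : ℂ → ℂ} {c : ℂ} {r : ℝ} {k l : ℤ} (h1 : HasWind F c r k)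
    (h2 : HasWind G c r l) : HasWind (fun x => F x / G x) c r (k - l) := LoopWind.div h1 h2

theorem HasWind.zpow {F : ℂ → ℂ} {c : ℂ} {r : ℝ} {k : ℤ} (h1 : HasWind F c r k) (n : ℤ) :
    HasWind (fun x => F x ^ n) c r (n * k) := LoopWind.zpow h1 n

theorem HasWind.sub_center {c : ℂ} {r : ℝ} (hr : 0 < r) :
    HasWind (fun x => x - c) c r 1 := by
  refine ⟨fun s => Real.log r + s * Complex.I, by fun_prop, fun s => ?_, fun s => ?_⟩
  · rw [Complex.exp_add, ← Complex.ofReal_exp, Real.exp_log hr]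
    simp [circleMap]
  · push_cast; ring

/-- Rouché: functions which are close on a circle have the same winding number. -/
theorem HasWind.of_norm_sub_lt {F G : ℂ → ℂ} {c : ℂ} {r : ℝ} {k : ℤ} (hr : 0 ≤ r)
    (hG : HasWind G c r k) (hFc : ContinuousOn F (sphere c r)) (hGc : ContinuousOn G (sphere c r))
    (h : ∀ x ∈ sphere c r, ‖F x - G x‖ < ‖G x‖) : HasWind F c r k := by
  have hne : ∀ x ∈ sphere c r, G x ≠ 0 := fun x hx => by
    rw [← norm_ne_zero_iff]; exact ((norm_nonneg _).trans_lt (h x hx)).ne'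
  have h1 : HasWind (fun x => F x / G x) c r 0 := by
    refine HasWind.of_slitPlane hr (hFc.div hGc hne) fun x hx => ?_
    have : F x / G x = 1 + (F x - G x) / G x := by
      have := hne x hx
      field_simp; ring
    rw [this]
    refine Complex.mem_slitPlane_of_norm_lt_one ?_
    rw [norm_div, div_lt_one ((norm_nonneg _).trans_lt (h x hx))]
    exact h x hx
  simpa using (h1.mul hG).congr hr fun x hx => div_mul_cancel₀ _ (hne x hx)

theorem HasWind.sub_interior {c o : ℂ} {r : ℝ} (ho : o ∈ ball c r) :
    HasWind (fun x => x - o) c r 1 := by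
  have hr : 0 < r := dist_nonneg.trans_lt ho
  refine HasWind.of_norm_sub_lt hr.le (HasWind.sub_center hr) (by fun_prop) (by fun_prop)
    fun x hx => ?_
  rw [mem_sphere_iff_norm.mp hx, ← dist_eq_norm]
  simpa [dist_eq_norm, norm_sub_rev] using ho

theorem HasWind.sub_exterior {c o : ℂ} {r : ℝ} (hr : 0 ≤ r) (ho : o ∉ closedBall c r) :
    HasWind (fun x => x - o) c r 0 :=
  HasWind.of_closedBall hr (by fun_prop) fun x hx h => ho (sub_eq_zero.mp h ▸ hx)

/-- A continuous periodic function on `ℝ` descends to the Jordan curve parametrized by `κ`. -/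
theorem exists_descent {κ : ℝ → ℂ} (hκ : Continuous κ)
    (hκp : Function.Periodic κ (2 * Real.pi))
    (hinj : ∀ s t, κ s = κ t → ∃ k : ℤ, s = t + k * (2 * Real.pi)) {H : ℝ → ℂ}
    (hH : Continuous H) (hHp : Function.Periodic H (2 * Real.pi)) :
    ∃ h : ℂ → ℂ, ContinuousOn h (range κ) ∧ ∀ s, h (κ s) = H s := by
  have hf : Function.FactorsThrough H κ := fun s t hst => by
    obtain ⟨k, rfl⟩ := hinj s t hst
    exact hHp.int_mul k t
  have hh : ∀ s, Function.extend κ H 0 (κ s) = H s := fun s => hf.extend_apply 0 s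
  refine ⟨Function.extend κ H 0, ?_, hh⟩
  rw [continuousOn_iff_isClosed]
  intro t ht
  refine ⟨κ '' (H ⁻¹' t ∩ Icc 0 (2 * Real.pi)), ?_, ?_⟩
  · exact ((isCompact_Icc.inter_left (ht.preimage hH)).image hκ).isClosed
  · ext x
    constructor
    · rintro ⟨hx, s, rfl⟩
      refine ⟨?_, s, rfl⟩
      obtain ⟨y, hy, hxy⟩ := hκp.exists_mem_Ico₀ Real.two_pi_pos s
      refine ⟨y, ⟨?_, Ico_subset_Icc_self hy⟩, hxy.symm⟩
      rw [mem_preimage, hxy, hh] at hx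
      exact hx
    · rintro ⟨⟨s, ⟨hs, -⟩, rfl⟩, hx⟩
      exact ⟨by rw [mem_preimage, hh]; exact hs, hx⟩

theorem circleMap_eq_imp {c : ℂ} {r : ℝ} (hr : r ≠ 0) (s t : ℝ)
    (h : circleMap c r s = circleMap c r t) : ∃ k : ℤ, s = t + k * (2 * Real.pi) := by
  obtain ⟨n, hn⟩ := (circleMap_eq_circleMap_iff c hr).mp h
  refine ⟨n, ?_⟩
  have := congrArg Complex.im hn
  simpa using this

theorem HasWind.exists_log {F : ℂ → ℂ} {c : ℂ} {r : ℝ} {k : ℤ} (hr : 0 < r)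
    (hF : HasWind F c r k) : ∃ h : ℂ → ℂ, ContinuousOn h (sphere c r) ∧
      ∀ x ∈ sphere c r, F x = Complex.exp (h x) * (x - c) ^ k := by
  obtain ⟨H, hH, he, hp⟩ := hF
  obtain ⟨H', hH', he', hp'⟩ := (HasWind.sub_center (c := c) hr).zpow k
  obtain ⟨h, hh, hhe⟩ := exists_descent (continuous_circleMap c r) (periodic_circleMap c r)
    (circleMap_eq_imp hr.ne') (H := fun s => H s - H' s) (by fun_prop)
    (fun s => by beta_reduce; rw [hp, hp']; push_cast; ring)
  rw [range_circleMap, abs_of_pos hr] at hh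
  refine ⟨h, hh, fun x hx => ?_⟩
  rw [← abs_of_pos hr, ← range_circleMap] at hx
  obtain ⟨s, rfl⟩ := hx
  beta_reduce at he he'
  rw [hhe, Complex.exp_sub, ← he, ← he', div_mul_cancel₀]
  rw [he']; exact Complex.exp_ne_zero _

theorem IsSchottkyFamily.pos {I : Type*} {Ω : Set ℂ} {c : I → ℂ} {r : I → ℝ}
    (h : IsSchottkyFamily Ω c r) (i : I) : 0 < r i := h.1 i

theorem IsSchottkyFamily.subset {I : Type*} {Ω : Set ℂ} {c : I → ℂ} {r : I → ℝ}
    (h : IsSchottkyFamily Ω c r) (i : I) : closedBall (c i) (r i) ⊆ Ω := h.2.1 i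

theorem IsSchottkyFamily.disjoint {I : Type*} {Ω : Set ℂ} {c : I → ℂ} {r : I → ℝ}
    (h : IsSchottkyFamily Ω c r) {i j : I} (hij : i ≠ j) :
    Disjoint (closedBall (c i) (r i)) (closedBall (c j) (r j)) := h.2.2 hij

theorem frontier_notMem {Ω : Set ℂ} (hΩ : IsOpen Ω) {x : ℂ} (hx : x ∈ frontier Ω) : x ∉ Ω := by
  rw [hΩ.frontier_eq] at hx; exact hx.2

/-- Argument principle for zero-free functions: if a continuous nonvanishing function on
`closure Ω` minus finitely many round discs looks like `(x - q) ^ j` on the outer boundary, then the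
winding numbers along the holes add up to `j`. -/
theorem sum_wind_eq {ι : Type*} [Fintype ι] {Ω : Set ℂ} (hΩ : IsOpen Ω)
    (hb : Bornology.IsBounded Ω) {c : ι → ℂ} {r : ι → ℝ} (hfam : IsSchottkyFamily Ω c r)
    {F : ℂ → ℂ} (hF : ContinuousOn F (closure Ω \ ⋃ i, ball (c i) (r i)))
    (h0 : ∀ x ∈ closure Ω \ ⋃ i, ball (c i) (r i), F x ≠ 0)
    {k : ι → ℤ} (hk : ∀ i, HasWind F (c i) (r i) (k i)) {q : ℂ} (hq : q ∈ Ω) {j : ℤ}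
    {h : ℂ → ℂ} (hh : ContinuousOn h (frontier Ω))
    (hJ : ∀ x ∈ frontier Ω, F x = Complex.exp (h x) * (x - q) ^ j) : ∑ i, k i = j := by
  classical
  choose hi hic hie using fun i => (hk i).exists_log (hfam.pos i)
  -- glue the logarithms on the boundary circles
  set S : Set ℂ := frontier Ω ∪ ⋃ i, sphere (c i) (r i) with hS
  have hfs : ∀ {x i}, x ∈ frontier Ω → x ∉ closedBall (c i) (r i) := fun hx hx' =>
    frontier_notMem hΩ hx (hfam.subset _ hx')
  obtain ⟨T, hT, hTo, hTi⟩ : ∃ T : ℂ → ℂ, Continuous T ∧ (∀ x ∈ frontier Ω, T x = h x) ∧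
      ∀ i, ∀ x ∈ sphere (c i) (r i), T x = hi i x := by
    set P : Option ι → Set ℂ := fun o => o.elim (frontier Ω) fun i => sphere (c i) (r i) with hP
    set f : ℂ → ℂ := fun x => if hx : ∃ i, x ∈ sphere (c i) (r i) then hi hx.choose x else h x
      with hf
    have hf1 : ∀ x ∈ frontier Ω, f x = h x := fun x hx => by
      rw [hf]; simp only
      rw [dif_neg]
      rintro ⟨i, hxi⟩
      exact hfs hx (sphere_subset_closedBall hxi)
    have hf2 : ∀ i, ∀ x ∈ sphere (c i) (r i), f x = hi i x := fun i x hx => by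
      have hx' : ∃ i, x ∈ sphere (c i) (r i) := ⟨i, hx⟩
      rw [hf]; simp only
      rw [dif_pos hx']
      congr 1
      by_contra hne
      exact (hfam.disjoint hne).ne_of_mem (sphere_subset_closedBall hx'.choose_spec)
        (sphere_subset_closedBall hx) rfl
    have hPc : ∀ o, IsClosed (P o) := by
      rintro (_ | i)
      · exact isClosed_frontier
      · exact isClosed_sphere
    have hPf : ∀ o, ContinuousOn f (P o) := by
      rintro (_ | i)
      · exact hh.congr hf1
      · exact (hic i).congr (hf2 i)
    have hU : ContinuousOn f (⋃ o, P o) :=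
      (locallyFinite_of_finite P).continuousOn_iUnion hPc hPf
    obtain ⟨T, hT, hTe⟩ := tietze_complex (isClosed_iUnion_of_finite hPc) hU
    refine ⟨T, hT, fun x hx => ?_, fun i x hx => ?_⟩
    · rw [hTe (mem_iUnion.mpr ⟨none, hx⟩), hf1 x hx]
    · rw [hTe (mem_iUnion.mpr ⟨some i, hx⟩), hf2 i x hx]
  -- the auxiliary global function
  set K : Set ℂ := closure Ω \ ⋃ i, ball (c i) (r i) with hK
  have hKc : IsClosed K := isClosed_closure.sdiff (isOpen_iUnion fun i => isOpen_ball)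
  have hcK : ∀ i, ∀ x ∈ K, x ≠ c i := fun i x hx hxc =>
    hx.2 (mem_iUnion.mpr ⟨i, hxc ▸ mem_ball_self (hfam.pos i)⟩)
  set G1 : ℂ → ℂ := fun x => F x * Complex.exp (- T x) * ∏ i, (x - c i) ^ (- k i) with hG1
  set G2 : ι → ℂ → ℂ := fun i x => ∏ l ∈ Finset.univ.erase i, (x - c l) ^ (- k l) with hG2
  set G3 : ℂ → ℂ := fun x => (x - q) ^ j * ∏ i, (x - c i) ^ (- k i) with hG3
  have hzc : ∀ (a : ℂ) (n : ℤ) (s : Set ℂ), (∀ x ∈ s, x ≠ a) →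
      ContinuousOn (fun x => (x - a) ^ n) s := fun a n s hs =>
    ContinuousOn.zpow₀ (by fun_prop) n fun x hx => Or.inl (sub_ne_zero.mpr (hs x hx))
  have hzn : ∀ (a : ℂ) (n : ℤ) (x : ℂ), x ≠ a → (x - a) ^ n ≠ 0 := fun a n x hx =>
    zpow_ne_zero _ (sub_ne_zero.mpr hx)
  have hG1c : ContinuousOn G1 K :=
    (hF.mul hT.neg.cexp.continuousOn).mul
      (continuousOn_finsetProd _ fun i _ => hzc _ _ _ (hcK i))
  have hG1n : ∀ x ∈ K, G1 x ≠ 0 := fun x hx =>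
    mul_ne_zero (mul_ne_zero (h0 x hx) (Complex.exp_ne_zero _))
      (Finset.prod_ne_zero_iff.mpr fun i _ => hzn _ _ _ (hcK i x hx))
  have hcB : ∀ i, ∀ x ∈ closedBall (c i) (r i), ∀ l ∈ Finset.univ.erase i, x ≠ c l := by
    intro i x hx l hl hxl
    exact (hfam.disjoint (Finset.ne_of_mem_erase hl)).ne_of_mem
      (mem_closedBall_self (hfam.pos l).le) hx hxl.symm
  have hG2c : ∀ i, ContinuousOn (G2 i) (closedBall (c i) (r i)) := fun i =>
    continuousOn_finsetProd _ fun l hl => hzc _ _ _ fun x hx => hcB i x hx l hl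
  have hG2n : ∀ i, ∀ x ∈ closedBall (c i) (r i), G2 i x ≠ 0 := fun i x hx =>
    Finset.prod_ne_zero_iff.mpr fun l hl => hzn _ _ _ (hcB i x hx l hl)
  have hqO : ∀ a ∈ Ω, ∀ x ∈ Ωᶜ, x ≠ a := fun a ha x hx hxa => hx (hxa ▸ ha)
  have hcΩ : ∀ i, c i ∈ Ω := fun i => hfam.subset i (mem_closedBall_self (hfam.pos i).le)
  have hG3c : ContinuousOn G3 Ωᶜ :=
    (hzc _ _ _ (hqO q hq)).mul (continuousOn_finsetProd _ fun i _ => hzc _ _ _ (hqO _ (hcΩ i)))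
  have hG3n : ∀ x ∈ Ωᶜ, G3 x ≠ 0 := fun x hx =>
    mul_ne_zero (hzn _ _ _ (hqO q hq x hx))
      (Finset.prod_ne_zero_iff.mpr fun i _ => hzn _ _ _ (hqO _ (hcΩ i) x hx))
  have h12 : ∀ i, ∀ x ∈ sphere (c i) (r i), G1 x = G2 i x := by
    intro i x hx
    have hxc : x ≠ c i := fun hxc => by
      rw [hxc, mem_sphere, dist_self] at hx
      exact (hfam.pos i).ne hx
    have h5 : (x - c i) ^ k i ≠ 0 := zpow_ne_zero _ (sub_ne_zero.mpr hxc)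
    simp only [hG1, hG2]
    rw [← Finset.mul_prod_erase _ _ (Finset.mem_univ i), hie i x hx, hTi i x hx, Complex.exp_neg,
      zpow_neg]
    have := Complex.exp_ne_zero (hi i x)
    field_simp
  have h13 : ∀ x ∈ frontier Ω, G1 x = G3 x := by
    intro x hx
    simp only [hG1, hG3]
    rw [hJ x hx, hTo x hx, Complex.exp_neg]
    have := Complex.exp_ne_zero (h x)
    field_simp
  set G : ℂ → ℂ := fun x => if hx : ∃ i, x ∈ closedBall (c i) (r i) then G2 hx.choose x
    else if x ∈ Ω then G1 x else G3 x with hG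
  have e2 : ∀ i, ∀ x ∈ closedBall (c i) (r i), G x = G2 i x := fun i x hx => by
    have hx' : ∃ i, x ∈ closedBall (c i) (r i) := ⟨i, hx⟩
    rw [hG]; simp only
    rw [dif_pos hx']
    congr 1
    by_contra hne
    exact (hfam.disjoint hne).ne_of_mem hx'.choose_spec hx rfl
  have e3 : ∀ x ∈ Ωᶜ, G x = G3 x := fun x hx => by
    rw [hG]; simp only
    rw [dif_neg, if_neg hx]
    rintro ⟨i, hxi⟩
    exact hx (hfam.subset i hxi)
  have e1 : ∀ x ∈ K, G x = G1 x := fun x hx => by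
    by_cases hx1 : ∃ i, x ∈ closedBall (c i) (r i)
    · obtain ⟨i, hxi⟩ := hx1
      rw [e2 i x hxi, h12 i x]
      rcases (mem_closedBall.mp hxi).lt_or_eq with h6 | h6
      · exact (hx.2 (mem_iUnion.mpr ⟨i, h6⟩)).elim
      · exact h6
    by_cases hx2 : x ∈ Ω
    · rw [hG]; simp only
      rw [dif_neg hx1, if_pos hx2]
    · rw [e3 x hx2, h13 x]
      rw [hΩ.frontier_eq]
      exact ⟨hx.1, hx2⟩
  have hcov : ∀ x, x ∈ K ∨ (∃ i, x ∈ closedBall (c i) (r i)) ∨ x ∈ Ωᶜ := fun x => by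
    by_cases hx : x ∈ Ω
    · by_cases hx1 : ∃ i, x ∈ closedBall (c i) (r i)
      · exact Or.inr (Or.inl hx1)
      · refine Or.inl ⟨subset_closure hx, ?_⟩
        rw [mem_iUnion]
        rintro ⟨i, hxi⟩
        exact hx1 ⟨i, ball_subset_closedBall hxi⟩
    · exact Or.inr (Or.inr hx)
  have hGc : Continuous G := by
    set P : Option (Option ι) → Set ℂ := fun o => o.elim K fun o => o.elim Ωᶜ fun i =>
      closedBall (c i) (r i) with hP
    refine (locallyFinite_of_finite P).continuous ?_ ?_ ?_
    · rw [eq_univ_iff_forall]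
      intro x
      rw [mem_iUnion]
      rcases hcov x with hx | ⟨i, hx⟩ | hx
      exacts [⟨none, hx⟩, ⟨some (some i), hx⟩, ⟨some none, hx⟩]
    · rintro (_ | _ | i)
      exacts [hKc, hΩ.isClosed_compl, isClosed_closedBall]
    · rintro (_ | _ | i)
      exacts [hG1c.congr e1, hG3c.congr e3, (hG2c i).congr (e2 i)]
  have hGn : ∀ x, G x ≠ 0 := fun x => by
    rcases hcov x with hx | ⟨i, hx⟩ | hx
    · rw [e1 x hx]; exact hG1n x hx
    · rw [e2 i x hx]; exact hG2n i x hx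
    · rw [e3 x hx]; exact hG3n x hx
  obtain ⟨ρ, hρ⟩ := hb.subset_ball (0 : ℂ)
  have hρ0 : 0 < ρ := dist_nonneg.trans_lt (hρ hq)
  have w0 : HasWind G 0 ρ 0 := HasWind.of_closedBall hρ0.le hGc.continuousOn fun x _ => hGn x
  have wp : ∀ s : Finset ι, HasWind (fun x => ∏ i ∈ s, (x - c i) ^ (- k i)) 0 ρ
      (∑ i ∈ s, - k i) := fun s => by
    induction s using Finset.induction_on with
    | empty =>
      simp only [Finset.prod_empty, Finset.sum_empty]
      exact HasWind.of_closedBall hρ0.le (by fun_prop) (by simp)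
    | insert i s his ih =>
      simp only [Finset.prod_insert his, Finset.sum_insert his]
      simpa using ((HasWind.sub_interior (hρ (hcΩ i))).zpow (- k i)).mul ih
  have w3 : HasWind G3 0 ρ (j * 1 + ∑ i, - k i) :=
    ((HasWind.sub_interior (hρ hq)).zpow j).mul (wp _)
  have w3' : HasWind G3 0 ρ 0 := w0.congr hρ0.le fun x hx => e3 x fun hxΩ => by
    have := hρ hxΩ
    rw [mem_ball, mem_sphere.mp hx] at this
    exact lt_irrefl _ this
  have := LoopWind.unique w3 w3'
  rw [Finset.sum_neg_distrib] at this
  linarith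

/-- Winding of `∂Ω` about a point of `Ω` does not depend on the point. -/
theorem exists_log_relation {Ω : Set ℂ} (hΩ : IsOpen Ω) (hconn : IsPreconnected Ω) {q q' : ℂ}
    (hq : q ∈ Ω) (hq' : q' ∈ Ω) : ∃ h : ℂ → ℂ, ContinuousOn h (frontier Ω) ∧
      ∀ x ∈ frontier Ω, x - q = Complex.exp (h x) * (x - q') := by
  have hne : ∀ x ∈ frontier Ω, ∀ y ∈ Ω, x - y ≠ 0 := fun x hx y hy hxy =>
    frontier_notMem hΩ hx (sub_eq_zero.mp hxy ▸ hy)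
  refine hconn.induction₂ (fun q q' => ∃ h : ℂ → ℂ, ContinuousOn h (frontier Ω) ∧
      ∀ x ∈ frontier Ω, x - q = Complex.exp (h x) * (x - q')) ?_ ?_ ?_ hq hq'
  · intro q hq
    obtain ⟨ε, hε, hball⟩ := Metric.isOpen_iff.mp hΩ q hq
    refine mem_nhdsWithin_of_mem_nhds ?_
    filter_upwards [inter_mem (ball_mem_nhds q (half_pos hε)) (hΩ.mem_nhds hq)] with y hy
    refine ⟨fun x => Complex.log ((x - q) / (x - y)), ?_, fun x hx => ?_⟩
    · refine ContinuousOn.clog (ContinuousOn.div (by fun_prop) (by fun_prop)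
        fun x hx => hne x hx y hy.2) fun x hx => ?_
      have h1 := hne x hx y hy.2
      have h2 : (x - q) / (x - y) = 1 + (y - q) / (x - y) := by field_simp; ring
      rw [h2]
      refine Complex.mem_slitPlane_of_norm_lt_one ?_
      have h3 : ε ≤ dist x q := by
        by_contra! h4
        exact frontier_notMem hΩ hx (hball h4)
      have h5 : dist y q < ε / 2 := hy.1
      have h6 : dist x q ≤ dist x y + dist y q := dist_triangle _ _ _
      rw [norm_div, ← dist_eq_norm, ← dist_eq_norm, div_lt_one (by linarith)]
      linarith
    · rw [Complex.exp_log (div_ne_zero (hne x hx q hq) (hne x hx y hy.2)),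
        div_mul_cancel₀ _ (hne x hx y hy.2)]
  · rintro x y z - - - ⟨h, hh, he⟩ ⟨h', hh', he'⟩
    refine ⟨fun x => h x + h' x, hh.add hh', fun x hx => ?_⟩
    rw [he x hx, he' x hx, Complex.exp_add, mul_assoc]
  · rintro x y - - ⟨h, hh, he⟩
    refine ⟨fun x => - h x, hh.neg, fun x hx => ?_⟩
    rw [he x hx, Complex.exp_neg, inv_mul_cancel_left₀ (Complex.exp_ne_zero _)]

theorem exists_affine_factor {Ω : Set ℂ} (hΩ : IsOpen Ω) (hconn : IsPreconnected Ω)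
    (hfr : (frontier Ω).Nonempty) {p : ℂ} (hp : p ∈ Ω) {α β : ℂ}
    (hL : ∀ x ∈ frontier Ω, α * x + β ≠ 0) :
    ∃ (j : ℤ) (D h : ℂ → ℂ), j ≤ 1 ∧ Differentiable ℂ D ∧ (∀ x ∈ closure Ω, D x ≠ 0) ∧
      ContinuousOn h (frontier Ω) ∧
      ∀ x ∈ frontier Ω, α * x + β = Complex.exp (h x) * D x * (x - p) ^ j := by
  by_cases hz : ∃ x0 ∈ Ω, α * x0 + β = 0
  · obtain ⟨x0, hx0, hz⟩ := hz
    have hα : α ≠ 0 := by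
      rintro rfl
      obtain ⟨x, hx⟩ := hfr
      exact hL x hx (by simpa using hz)
    obtain ⟨h, hh, he⟩ := exists_log_relation hΩ hconn hx0 hp
    refine ⟨1, fun _ => α, h, le_rfl, by fun_prop, fun _ _ => hα, hh, fun x hx => ?_⟩
    rw [zpow_one, mul_right_comm, ← he x hx, ← sub_zero (α * x + β), ← hz]
    ring
  · push Not at hz
    refine ⟨0, fun x => α * x + β, fun _ => 0, by norm_num, by fun_prop, fun x hx => ?_,
      continuousOn_const, fun x hx => by simp⟩
    rw [closure_eq_interior_union_frontier, hΩ.interior_eq] at hx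
    exact hx.elim (hz x) (hL x)

theorem notMem_of_mem_frontier_connectedComponentIn {A : Set ℂ} (hA : IsOpen A) {x₀ x : ℂ}
    (hx : x ∈ frontier (connectedComponentIn A x₀)) : x ∉ A := by
  intro hxA
  have ho : IsOpen (connectedComponentIn A x₀) := hA.connectedComponentIn
  have ho' : IsOpen (connectedComponentIn A x) := hA.connectedComponentIn
  obtain ⟨y, hy, hy'⟩ := mem_closure_iff.mp (frontier_subset_closure hx) _ ho'
    (mem_connectedComponentIn hxA)
  refine frontier_notMem ho hx ?_
  rw [connectedComponentIn_eq hy', ← connectedComponentIn_eq hy]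
  exact mem_connectedComponentIn hxA

theorem eq_zero_on_closure_connectedComponentIn {A K : Set ℂ} (hA : IsOpen A) (hK : IsClosed K)
    (hAK : A ⊆ K) {F : ℂ → ℂ} (hF : ContinuousOn F K) (hFd : DifferentiableOn ℂ F A) {x₀ : ℂ}
    (hx₀ : x₀ ∈ A) (h0 : ∀ᶠ x in 𝓝 x₀, F x = 0) :
    ∀ x ∈ closure (connectedComponentIn A x₀), F x = 0 := by
  have h1 : EqOn F 0 (connectedComponentIn A x₀) :=
    ((hFd.analyticOnNhd hA).mono (connectedComponentIn_subset A x₀)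
      ).eqOn_zero_of_preconnected_of_eventuallyEq_zero
      isPreconnected_connectedComponentIn (mem_connectedComponentIn hx₀) h0
  have h2 : closure (connectedComponentIn A x₀) ⊆ K :=
    closure_minimal ((connectedComponentIn_subset A x₀).trans hAK) hK
  exact h1.of_subset_closure (hF.mono h2) continuousOn_const subset_closure subset_rfl

theorem isOpen_sdiff_closedBalls {ι : Type*} [Finite ι] {Ω : Set ℂ} (hΩ : IsOpen Ω) (c : ι → ℂ)
    (r : ι → ℝ) : IsOpen (Ω \ ⋃ i, closedBall (c i) (r i)) :=
  hΩ.sdiff (isClosed_iUnion_of_finite fun _ => isClosed_closedBall)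

theorem sdiff_closedBalls_subset {ι : Type*} {Ω : Set ℂ} (c : ι → ℂ) (r : ι → ℝ) :
    Ω \ ⋃ i, closedBall (c i) (r i) ⊆ closure Ω \ ⋃ i, ball (c i) (r i) :=
  sdiff_subset_sdiff subset_closure (iUnion_mono fun _ => ball_subset_closedBall)

theorem mem_frontier_or_sphere {ι : Type*} {Ω : Set ℂ} (hΩ : IsOpen Ω) {c : ι → ℂ} {r : ι → ℝ}
    {x : ℂ} (hx : x ∈ closure Ω \ ⋃ i, ball (c i) (r i))
    (hxA : x ∉ Ω \ ⋃ i, closedBall (c i) (r i)) :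
    x ∈ frontier Ω ∨ ∃ i, x ∈ sphere (c i) (r i) := by
  by_cases hxΩ : x ∈ Ω
  · right
    have h1 : x ∈ ⋃ i, closedBall (c i) (r i) := by
      by_contra h
      exact hxA ⟨hxΩ, h⟩
    obtain ⟨i, hi⟩ := mem_iUnion.mp h1
    refine ⟨i, ?_⟩
    rcases (mem_closedBall.mp hi).lt_or_eq with h6 | h6
    · exact (hx.2 (mem_iUnion.mpr ⟨i, h6⟩)).elim
    · exact h6
  · left
    rw [hΩ.frontier_eq]
    exact ⟨hx.1, hxΩ⟩

theorem HasWind.ne_zero {F : ℂ → ℂ} {c : ℂ} {r : ℝ} {k : ℤ} (hr : 0 < r) (h : HasWind F c r k)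
    {x : ℂ} (hx : x ∈ sphere c r) : F x ≠ 0 := by
  obtain ⟨H, -, he, -⟩ := h
  rw [← abs_of_pos hr, ← range_circleMap] at hx
  obtain ⟨s, rfl⟩ := hx
  exact (he s).trans_ne (Complex.exp_ne_zero _)

theorem nonempty_frontier_of_isBounded {Ω : Set ℂ} (hb : Bornology.IsBounded Ω)
    (hne : Ω.Nonempty) : (frontier Ω).Nonempty := by
  rw [nonempty_iff_ne_empty, Ne, frontier_eq_empty_iff]
  rintro (h | h)
  · exact hne.ne_empty h
  · exact NormedSpace.unbounded_univ ℝ ℂ (h ▸ hb)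

/-- One half of the argument principle on `Ω` minus finitely many round discs: zeros of `F` only
contribute positively. -/
theorem sum_wind_le {ι : Type*} [Fintype ι] {Ω : Set ℂ} (hΩ : IsOpen Ω) (hconn : IsPreconnected Ω)
    (hb : Bornology.IsBounded Ω) {c : ι → ℂ} {r : ι → ℝ} (hfam : IsSchottkyFamily Ω c r)
    {F : ℂ → ℂ} (hF : ContinuousOn F (closure Ω \ ⋃ i, ball (c i) (r i)))
    (hFd : DifferentiableOn ℂ F (Ω \ ⋃ i, closedBall (c i) (r i)))
    {k : ι → ℤ} (hk : ∀ i, HasWind F (c i) (r i) (k i)) {q : ℂ} (hq : q ∈ Ω) {j : ℤ}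
    {h : ℂ → ℂ} (hh : ContinuousOn h (frontier Ω))
    (hJ : ∀ x ∈ frontier Ω, F x = Complex.exp (h x) * (x - q) ^ j) : ∑ i, k i ≤ j := by
  set K : Set ℂ := closure Ω \ ⋃ i, ball (c i) (r i) with hK
  set A : Set ℂ := Ω \ ⋃ i, closedBall (c i) (r i) with hA
  have hAo : IsOpen A := isOpen_sdiff_closedBalls hΩ c r
  have hAK : A ⊆ K := sdiff_closedBalls_subset c r
  have hKc : IsClosed K := isClosed_closure.sdiff (isOpen_iUnion fun i => isOpen_ball)
  have hKcomp : IsCompact K := isCompact_of_isClosed_isBounded hKc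
    (hb.closure.subset sdiff_subset)
  have hbdry : ∀ x ∈ K, F x = 0 → x ∈ A := by
    intro x hx h0
    by_contra hxA
    rcases mem_frontier_or_sphere hΩ hx hxA with h1 | ⟨i, h1⟩
    · rw [hJ x h1] at h0
      refine mul_ne_zero (Complex.exp_ne_zero _) (zpow_ne_zero _ (sub_ne_zero.mpr ?_)) h0
      rintro rfl
      exact frontier_notMem hΩ h1 hq
    · exact (hk i).ne_zero (hfam.pos i) h1 h0
  have hiso : ∀ x ∈ A, ¬ ∀ᶠ y in 𝓝 x, F y = 0 := by
    intro x hx h0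
    have h1 := eq_zero_on_closure_connectedComponentIn hAo hKc hAK hF hFd hx h0
    obtain ⟨y, hy⟩ := nonempty_frontier_of_isBounded
      (hb.subset ((connectedComponentIn_subset A x).trans sdiff_subset))
      ⟨x, mem_connectedComponentIn hx⟩
    have hyK : y ∈ K :=
      closure_minimal ((connectedComponentIn_subset A x).trans hAK) hKc (frontier_subset_closure hy)
    exact notMem_of_mem_frontier_connectedComponentIn hAo hy
      (hbdry y hyK (h1 y (frontier_subset_closure hy)))
  have hfin : (K ∩ F ⁻¹' {0}).Finite := by
    have hc : IsCompact (K ∩ F ⁻¹' {0}) :=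
      hKcomp.of_isClosed_subset (hF.preimage_isClosed_of_isClosed hKc isClosed_singleton)
        inter_subset_left
    refine hc.induction_on (p := Set.Finite) finite_empty (fun s t hst ht => ht.subset hst)
      (fun s t hs ht => hs.union ht) fun x hx => ?_
    have hxA := hbdry x hx.1 hx.2
    have h1 := ((hFd.analyticOnNhd hAo x hxA).eventually_eq_zero_or_eventually_ne_zero).resolve_left
      (hiso x hxA)
    rw [eventually_nhdsWithin_iff] at h1
    refine ⟨{x}, ?_, finite_singleton x⟩
    rw [mem_nhdsWithin_iff_eventually]
    filter_upwards [h1] with y hy hy'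
    by_contra hne
    exact hy hne hy'.2
  clear_value A K
  induction hN : (K ∩ F ⁻¹' {0}).ncard using Nat.strong_induction_on generalizing F j h with
  | _ N ih =>
  rcases (K ∩ F ⁻¹' {0}).eq_empty_or_nonempty with hZ | ⟨q0, hq0⟩
  · subst hK
    refine (sum_wind_eq hΩ hb hfam hF (fun x hx h0 => ?_) hk hq hh hJ).le
    exact notMem_empty x (hZ ▸ ⟨hx, h0⟩)
  have hq0A := hbdry q0 hq0.1 hq0.2
  have hq0Ω : q0 ∈ Ω := by rw [hA] at hq0A; exact hq0A.1
  obtain ⟨n, G, hGa, hG0, hGe⟩ :=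
    ((hFd.analyticOnNhd hAo q0 hq0A).exists_eventuallyEq_pow_smul_nonzero_iff).mpr (hiso q0 hq0A)
  obtain ⟨h', hh', he'⟩ := exists_log_relation hΩ hconn hq0Ω hq
  set F' : ℂ → ℂ := Function.update (fun x => F x / (x - q0) ^ n) q0 (G q0) with hF'
  have hF'ne : ∀ x, x ≠ q0 → F' x = F x / (x - q0) ^ n := fun x hx => by
    rw [hF', Function.update_of_ne hx]
  have hF'q : F' q0 = G q0 := by rw [hF', Function.update_self]
  have hF'G : F' =ᶠ[𝓝 q0] G := by
    filter_upwards [hGe] with x hx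
    by_cases hxq : x = q0
    · rw [hxq, hF'q]
    · rw [hF'ne x hxq, hx, smul_eq_mul,
        mul_div_cancel_left₀ _ (pow_ne_zero _ (sub_ne_zero.mpr hxq))]
  have hF'loc : ∀ x, x ≠ q0 → F' =ᶠ[𝓝 x] fun x => F x / (x - q0) ^ n := fun x hx => by
    filter_upwards [isOpen_ne.mem_nhds hx] with y hy using hF'ne y hy
  have hzero : ∀ x ∈ K, F' x = 0 → F x = 0 ∧ x ≠ q0 := by
    intro x hx h0
    have hxq : x ≠ q0 := by
      rintro rfl
      exact hG0 (hF'q ▸ h0)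
    rw [hF'ne x hxq, div_eq_zero_iff] at h0
    exact ⟨h0.resolve_right (pow_ne_zero _ (sub_ne_zero.mpr hxq)), hxq⟩
  have hZ' : K ∩ F' ⁻¹' {0} ⊆ (K ∩ F ⁻¹' {0}) \ {q0} := fun x hx =>
    ⟨⟨hx.1, (hzero x hx.1 hx.2).1⟩, (hzero x hx.1 hx.2).2⟩
  have hF'd : DifferentiableOn ℂ F' A := by
    intro x hx
    by_cases hxq : x = q0
    · subst hxq
      exact (hGa.differentiableAt.congr_of_eventuallyEq hF'G).differentiableWithinAt
    · refine DifferentiableAt.differentiableWithinAt ?_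
      refine DifferentiableAt.congr_of_eventuallyEq ?_ (hF'loc x hxq)
      have h1 : x - q0 ≠ 0 := sub_ne_zero.mpr hxq
      have h2 : DifferentiableAt ℂ (fun x => (x - q0) ^ n) x := by fun_prop
      exact (hFd.differentiableAt (hAo.mem_nhds hx)).div h2 (pow_ne_zero _ h1)
  have hF'c : ContinuousOn F' K := by
    intro x hx
    by_cases hxq : x = q0
    · subst hxq
      exact (hGa.continuousAt.congr hF'G.symm).continuousWithinAt
    · have h1 : x - q0 ≠ 0 := sub_ne_zero.mpr hxq
      have h2 : ContinuousWithinAt (fun x => (x - q0) ^ n) K x := by fun_prop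
      exact ((hF x hx).div h2 (pow_ne_zero _ h1)).congr_of_eventuallyEq
        ((hF'loc x hxq).filter_mono nhdsWithin_le_nhds) (hF'ne x hxq)
  have hkey : ∑ i, k i ≤ j - n := by
    refine ih (K ∩ F' ⁻¹' {0}).ncard ?_ (hF := hF'c) (hFd := hF'd) (hk := fun i => ?_)
      (h := fun x => h x - n * h' x) (hh := hh.sub (continuousOn_const.mul hh'))
      (hJ := fun x hx => ?_) (hbdry := fun x hx h0 => hbdry x hx (hzero x hx h0).1)
      (hiso := fun x hx h0 => ?_) (hfin := hfin.subset (hZ'.trans sdiff_subset)) rfl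
    · rw [← hN]
      exact (ncard_le_ncard hZ' (hfin.subset sdiff_subset)).trans_lt
        (ncard_sdiff_singleton_lt_of_mem hq0 hfin)
    · have hq0i : q0 ∉ closedBall (c i) (r i) := fun hh => by
        rw [hA] at hq0A
        exact hq0A.2 (mem_iUnion.mpr ⟨i, hh⟩)
      have h1 := (hk i).div ((HasWind.sub_exterior (hfam.pos i).le hq0i).zpow n)
      simp only [mul_zero, sub_zero] at h1
      refine h1.congr (hfam.pos i).le fun x hx => ?_
      rw [hF'ne x fun h => hq0i (h ▸ sphere_subset_closedBall hx), zpow_natCast]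
    · have hxq0 : x ≠ q0 := fun h => frontier_notMem hΩ hx (h ▸ hq0Ω)
      have hxq : x - q ≠ 0 := sub_ne_zero.mpr fun h => frontier_notMem hΩ hx (h ▸ hq)
      rw [hF'ne x hxq0, hJ x hx, he' x hx, mul_pow, Complex.exp_sub, Complex.exp_nat_mul,
        zpow_sub₀ hxq, zpow_natCast]
      have := Complex.exp_ne_zero (h' x)
      field_simp
    · by_cases hxq : x = q0
      · subst hxq
        exact hG0 (hF'q ▸ h0.self_of_nhds)
      · refine hiso x hx ?_
        filter_upwards [h0, hF'loc x hxq, isOpen_ne.mem_nhds hxq] with y hy hy' hyq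
        rw [hy', div_eq_zero_iff] at hy
        exact hy.resolve_right (pow_ne_zero _ (sub_ne_zero.mpr hyq))
  have : (0 : ℤ) ≤ n := by positivity
  linarith

/-- If `H` is a logarithm of `e * X` on an interval, `e = exp E` and `X` avoids the negative reals,
then the increment of `H` is computed with the principal logarithm of `X`. -/
theorem log_increment {H E X : ℝ → ℂ} {s₁ s₂ : ℝ} (hs : s₁ ≤ s₂) (hH : Continuous H)
    (hE : Continuous E) (hX : Continuous X) (hX0 : ∀ s ∈ Icc s₁ s₂, X s ∈ Complex.slitPlane)
    (he : ∀ s, Complex.exp (H s) = Complex.exp (E s) * X s) :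
    H s₂ - H s₁ = E s₂ - E s₁ + (Complex.log (X s₂) - Complex.log (X s₁)) := by
  have : PreconnectedSpace (Icc s₁ s₂) := Subtype.preconnectedSpace isPreconnected_Icc
  have hc : Continuous fun s : Icc s₁ s₂ => H s - E s - Complex.log (X s) := by
    refine ((hH.comp continuous_subtype_val).sub (hE.comp continuous_subtype_val)).sub ?_
    exact Continuous.clog (hX.comp continuous_subtype_val) fun s => hX0 s s.2
  obtain ⟨k, hk⟩ := eq_of_exp_eq_one hc fun s => by
    have h1 := Complex.slitPlane_ne_zero (hX0 s s.2)
    rw [Complex.exp_sub, Complex.exp_sub, he, Complex.exp_log h1]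
    have := Complex.exp_ne_zero (E s)
    field_simp
  have h1 := hk ⟨s₁, left_mem_Icc.mpr hs⟩
  have h2 := hk ⟨s₂, right_mem_Icc.mpr hs⟩
  simp only at h1 h2
  linear_combination h2 - h1

theorem abs_arg_sub_arg_lt {ρ ρ' δ : ℝ} (hρ : 0 < ρ) (hρ' : 0 < ρ') {X Y : ℂ}
    (hX : X = ρ' - ρ * Complex.exp (-(δ * Complex.I)))
    (hY : Y = ρ - ρ' * Complex.exp (δ * Complex.I))
    (hXs : X ∈ Complex.slitPlane) (hYs : Y ∈ Complex.slitPlane) :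
    |X.arg - Y.arg| < Real.pi := by
  have hXr : X.re = ρ' - ρ * Real.cos δ := by
    rw [hX, ← neg_mul, ← Complex.ofReal_neg, Complex.sub_re, Complex.re_ofReal_mul,
      Complex.exp_ofReal_mul_I_re]
    simp
  have hXi : X.im = ρ * Real.sin δ := by
    rw [hX, ← neg_mul, ← Complex.ofReal_neg, Complex.sub_im, Complex.im_ofReal_mul,
      Complex.exp_ofReal_mul_I_im]
    simp
  have hYr : Y.re = ρ - ρ' * Real.cos δ := by
    rw [hY, Complex.sub_re, Complex.re_ofReal_mul, Complex.exp_ofReal_mul_I_re]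
    simp
  have hYi : Y.im = - (ρ' * Real.sin δ) := by
    rw [hY, Complex.sub_im, Complex.im_ofReal_mul, Complex.exp_ofReal_mul_I_im]
    simp
  have hX0 := Complex.slitPlane_ne_zero hXs
  have hY0 := Complex.slitPlane_ne_zero hYs
  have hXn : 0 < ‖X‖ := norm_pos_iff.mpr hX0
  have hYn : 0 < ‖Y‖ := norm_pos_iff.mpr hY0
  have hpos : 0 < ρ ^ 2 + ρ' ^ 2 - 2 * ρ * ρ' * Real.cos δ := by
    have h1 : ‖X‖ ^ 2 = ρ ^ 2 + ρ' ^ 2 - 2 * ρ * ρ' * Real.cos δ := by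
      rw [Complex.sq_norm, Complex.normSq_apply, hXr, hXi]
      linear_combination ρ ^ 2 * Real.sin_sq_add_cos_sq δ
    rw [← h1]; positivity
  have hsin : Real.sin (X.arg - Y.arg) * (‖X‖ * ‖Y‖) =
      (ρ ^ 2 + ρ' ^ 2 - 2 * ρ * ρ' * Real.cos δ) * Real.sin δ := by
    have e1 : Real.sin X.arg * ‖X‖ = X.im := by rw [Complex.sin_arg]; field_simp
    have e2 : Real.sin Y.arg * ‖Y‖ = Y.im := by rw [Complex.sin_arg]; field_simp
    have e3 : Real.cos X.arg * ‖X‖ = X.re := by rw [Complex.cos_arg hX0]; field_simp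
    have e4 : Real.cos Y.arg * ‖Y‖ = Y.re := by rw [Complex.cos_arg hY0]; field_simp
    rw [Real.sin_sub]
    calc _ = (Real.sin X.arg * ‖X‖) * (Real.cos Y.arg * ‖Y‖) -
          (Real.cos X.arg * ‖X‖) * (Real.sin Y.arg * ‖Y‖) := by ring
      _ = _ := by rw [e1, e2, e3, e4, hXr, hXi, hYr, hYi]; ring
  have hX1 := Complex.arg_le_pi X
  have hX2 := Complex.neg_pi_lt_arg X
  have hY1 := Complex.arg_le_pi Y
  have hY2 := Complex.neg_pi_lt_arg Y
  have hprod : 0 < ‖X‖ * ‖Y‖ := by positivity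
  rcases lt_trichotomy (Real.sin δ) 0 with hδ | hδ | hδ
  · have hs : Real.sin (X.arg - Y.arg) < 0 := by
      by_contra! h
      have := mul_nonneg h hprod.le
      rw [hsin] at this
      exact absurd this (not_le.mpr (mul_neg_of_pos_of_neg hpos hδ))
    have h1 : X.arg < 0 := Complex.arg_neg_iff.mpr (by rw [hXi]; exact mul_neg_of_pos_of_neg hρ hδ)
    have h2 : 0 ≤ Y.arg := Complex.arg_nonneg_iff.mpr (by rw [hYi]; nlinarith)
    rw [abs_lt]
    refine ⟨?_, by linarith⟩
    by_contra! h
    have := Real.sin_nonneg_of_nonneg_of_le_pi (x := X.arg - Y.arg + 2 * Real.pi) (by linarith)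
      (by linarith)
    rw [Real.sin_add_two_pi] at this
    linarith
  · have h1 : X.arg = 0 := Complex.arg_eq_zero_iff.mpr ⟨by
      rcases Complex.mem_slitPlane_iff.mp hXs with h | h
      · exact h.le
      · rw [hXi, hδ] at h; simp at h, by rw [hXi, hδ]; simp⟩
    have h2 : Y.arg = 0 := Complex.arg_eq_zero_iff.mpr ⟨by
      rcases Complex.mem_slitPlane_iff.mp hYs with h | h
      · exact h.le
      · rw [hYi, hδ] at h; simp at h, by rw [hYi, hδ]; simp⟩
    rw [h1, h2]; simpa using Real.pi_pos
  · have hs : 0 < Real.sin (X.arg - Y.arg) := by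
      by_contra! h
      have := mul_nonpos_of_nonpos_of_nonneg h hprod.le
      rw [hsin] at this
      exact absurd this (not_le.mpr (mul_pos hpos hδ))
    have h1 : 0 ≤ X.arg := Complex.arg_nonneg_iff.mpr (by rw [hXi]; positivity)
    have h2 : Y.arg < 0 := Complex.arg_neg_iff.mpr (by rw [hYi]; nlinarith)
    rw [abs_lt]
    refine ⟨by linarith, ?_⟩
    by_contra! h
    have := Real.sin_nonpos_of_nonpos_of_neg_pi_le (x := X.arg - Y.arg - 2 * Real.pi) (by linarith)
      (by linarith)
    rw [Real.sin_sub_two_pi] at this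
    linarith

theorem sub_mul_exp_mem_slitPlane {ρ ρ' δ : ℝ} (hρ : 0 < ρ) (hρ' : 0 < ρ')
    (h : ∀ k : ℤ, δ = k * (2 * Real.pi) → ρ < ρ') :
    (ρ' : ℂ) - ρ * Complex.exp (δ * Complex.I) ∈ Complex.slitPlane := by
  rw [Complex.mem_slitPlane_iff, Complex.sub_re, Complex.sub_im, Complex.re_ofReal_mul,
    Complex.im_ofReal_mul, Complex.exp_ofReal_mul_I_re, Complex.exp_ofReal_mul_I_im,
    Complex.ofReal_re, Complex.ofReal_im]
  by_cases hs : Real.sin δ = 0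
  · left
    rcases Real.sin_eq_zero_iff_cos_eq.mp hs with hc | hc
    · obtain ⟨k, hk⟩ := (Real.cos_eq_one_iff δ).mp hc
      have := h k hk.symm
      rw [hc]; linarith
    · rw [hc]; linarith
  · right
    simp [hs, hρ.ne']

/-- The winding number of the difference of two star-shaped loops whose relative radial order
changes at most twice is nonnegative. -/
theorem star_index {ρ ρ' Θ Φ : ℝ → ℝ} (hρc : Continuous ρ) (hρc' : Continuous ρ')
    (hΘc : Continuous Θ) (hΦc : Continuous Φ) (hρ : ∀ s, 0 < ρ s) (hρ' : ∀ s, 0 < ρ' s)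
    (hρp : ∀ s, ρ (s + 2 * Real.pi) = ρ s) (hρp' : ∀ s, ρ' (s + 2 * Real.pi) = ρ' s)
    (hΘp : ∀ s, Θ (s + 2 * Real.pi) = Θ s + 2 * Real.pi)
    (hΦp : ∀ s, Φ (s + 2 * Real.pi) = Φ s + 2 * Real.pi)
    (hΘm : Monotone Θ) (hΦm : Monotone Φ)
    (hne : ∀ s, (ρ' s : ℂ) * Complex.exp (Φ s * Complex.I) -
      ρ s * Complex.exp (Θ s * Complex.I) ≠ 0)
    {q : ℝ → ℝ} (hq1 : ∀ s, q s ≤ 0 → ∀ k : ℤ, Φ s - Θ s = k * (2 * Real.pi) → ρ s < ρ' s)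
    (hq2 : ∀ s, 0 ≤ q s → ∀ k : ℤ, Φ s - Θ s = k * (2 * Real.pi) → ρ' s < ρ s)
    (hq : (∀ s, q s ≤ 0) ∨ (∀ s, 0 ≤ q s) ∨ ∃ s₁ s₂, s₁ ≤ s₂ ∧ s₂ ≤ s₁ + 2 * Real.pi ∧
      (∀ s ∈ Icc s₁ s₂, q s ≤ 0) ∧ ∀ s ∈ Icc s₂ (s₁ + 2 * Real.pi), 0 ≤ q s) :
    ∃ k : ℤ, 0 ≤ k ∧ LoopWind (fun s => (ρ' s : ℂ) * Complex.exp (Φ s * Complex.I) -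
      ρ s * Complex.exp (Θ s * Complex.I)) k := by
  have hexp : ∀ x : ℝ, Complex.exp (((x + 2 * Real.pi : ℝ) : ℂ) * Complex.I) =
      Complex.exp (x * Complex.I) := fun x => by
    push_cast
    rw [add_mul, Complex.exp_add, Complex.exp_two_pi_mul_I, mul_one]
  obtain ⟨k, hk⟩ := LoopWind.exists (φ := fun s => (ρ' s : ℂ) * Complex.exp (Φ s * Complex.I) -
      ρ s * Complex.exp (Θ s * Complex.I)) (by fun_prop) hne
      (fun s => by rw [hρp, hρp', hΘp, hΦp, hexp, hexp])
  refine ⟨k, ?_, hk⟩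
  obtain ⟨H, hH, he, hp⟩ := hk
  beta_reduce at he
  set X : ℝ → ℂ := fun s => ρ' s - ρ s * Complex.exp (-(((Φ s - Θ s : ℝ) : ℂ) * Complex.I)) with hX
  set Y : ℝ → ℂ := fun s => ρ s - ρ' s * Complex.exp (((Φ s - Θ s : ℝ) : ℂ) * Complex.I) with hY
  have hXc : Continuous X := by fun_prop
  have hYc : Continuous Y := by fun_prop
  have hX1 : ∀ s, q s ≤ 0 → X s ∈ Complex.slitPlane := fun s hs => by
    have := sub_mul_exp_mem_slitPlane (δ := -(Φ s - Θ s)) (hρ s) (hρ' s) fun k hk =>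
      hq1 s hs (-k) (by push_cast; linarith)
    rwa [Complex.ofReal_neg, neg_mul] at this
  have hY1 : ∀ s, 0 ≤ q s → Y s ∈ Complex.slitPlane := fun s hs =>
    sub_mul_exp_mem_slitPlane (hρ' s) (hρ s) (hq2 s hs)
  have hXe : ∀ s, Complex.exp (H s) = Complex.exp (Φ s * Complex.I) * X s := fun s => by
    rw [← he, hX]
    simp only
    rw [mul_sub, mul_left_comm, ← Complex.exp_add]
    push_cast
    ring_nf
  have hYe : ∀ s, Complex.exp (H s) = Complex.exp (Θ s * Complex.I + Real.pi * Complex.I) * Y s :=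
      fun s => by
    rw [← he, hY, Complex.exp_add, Complex.exp_pi_mul_I]
    simp only
    have : Complex.exp (Φ s * Complex.I) = Complex.exp (Θ s * Complex.I) *
        Complex.exp (((Φ s - Θ s : ℝ) : ℂ) * Complex.I) := by
      rw [← Complex.exp_add]; push_cast; ring_nf
    rw [this]; ring
  have hper : ∀ s, Φ (s + 2 * Real.pi) - Θ (s + 2 * Real.pi) = Φ s - Θ s := fun s => by
    rw [hΦp, hΘp]; ring
  have hXp : ∀ s, X (s + 2 * Real.pi) = X s := fun s => by
    simp only [hX]; rw [hρp, hρp', hper]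
  have hYp : ∀ s, Y (s + 2 * Real.pi) = Y s := fun s => by
    simp only [hY]; rw [hρp, hρp', hper]
  have hpi := Real.pi_pos
  have hIX : ∀ s t, s ≤ t → (∀ x ∈ Icc s t, q x ≤ 0) →
      (H t).im - (H s).im = Φ t - Φ s + ((X t).arg - (X s).arg) := fun s t hst hqs => by
    have h1 := congrArg Complex.im (log_increment (E := fun s => Φ s * Complex.I) hst hH
      (by fun_prop)
      hXc (fun x hx => hX1 x (hqs x hx)) hXe)
    simpa [Complex.log_im] using h1
  have hIY : ∀ s t, s ≤ t → (∀ x ∈ Icc s t, 0 ≤ q x) →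
      (H t).im - (H s).im = Θ t - Θ s + ((Y t).arg - (Y s).arg) := fun s t hst hqs => by
    have h1 := congrArg Complex.im (log_increment
      (E := fun s => Θ s * Complex.I + Real.pi * Complex.I) hst hH (by fun_prop)
      hYc (fun x hx => hY1 x (hqs x hx)) hYe)
    simpa [Complex.log_im] using h1
  have hHp : ∀ s, (H (s + 2 * Real.pi)).im = (H s).im + 2 * Real.pi * k := fun s => by
    rw [hp]; simp
  have hfin : ∀ x : ℝ, 2 * Real.pi * k = x → -(2 * Real.pi) < x → 0 ≤ k := fun x hx hx' => by
    rw [← hx] at hx'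
    have : (-1 : ℝ) < k := by nlinarith
    have : (-1 : ℤ) < k := by exact_mod_cast this
    omega
  rcases hq with hq | hq | ⟨s₁, s₂, h12, h21, ha, hb⟩
  · have := hIX 0 (0 + 2 * Real.pi) (by linarith) fun x _ => hq x
    rw [hHp, hXp, hΦp] at this
    exact hfin (2 * Real.pi) (by linarith) (by linarith)
  · have := hIY 0 (0 + 2 * Real.pi) (by linarith) fun x _ => hq x
    rw [hHp, hYp, hΘp] at this
    exact hfin (2 * Real.pi) (by linarith) (by linarith)
  · have e1 := hIX s₁ s₂ h12 ha
    have e2 := hIY s₂ (s₁ + 2 * Real.pi) h21 hb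
    rw [hHp, hYp, hΘp] at e2
    have hY1' : Y s₁ ∈ Complex.slitPlane := by
      rw [← hYp]; exact hY1 _ (hb _ (right_mem_Icc.mpr h21))
    have d1 := abs_lt.mp (abs_arg_sub_arg_lt (hρ s₁) (hρ' s₁) rfl rfl
      (hX1 s₁ (ha _ (left_mem_Icc.mpr h12))) hY1')
    have d2 := abs_lt.mp (abs_arg_sub_arg_lt (hρ s₂) (hρ' s₂) rfl rfl
      (hX1 s₂ (ha _ (right_mem_Icc.mpr h12))) (hY1 s₂ (hb _ (left_mem_Icc.mpr h21))))
    have m1 := hΦm h12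
    have m2 := hΘm h21
    rw [hΘp] at m2
    have m3 := hΘm h12
    refine hfin (2 * Real.pi + (Φ s₂ - Φ s₁) - (Θ s₂ - Θ s₁) + ((X s₂).arg - (Y s₂).arg) -
      ((X s₁).arg - (Y s₁).arg)) (by linarith) ?_
    have m4 : Θ s₂ ≤ Θ s₁ + 2 * Real.pi := m2
    linarith [d1.1, d1.2, d2.1, d2.2]

theorem trig_sign_regions (K a φ : ℝ) (ha : 0 ≤ a) :
    (∀ s, K + a * Real.cos (s + φ) ≤ 0) ∨ (∀ s, 0 ≤ K + a * Real.cos (s + φ)) ∨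
      ∃ s₁ s₂, s₁ ≤ s₂ ∧ s₂ ≤ s₁ + 2 * Real.pi ∧
      (∀ s ∈ Icc s₁ s₂, K + a * Real.cos (s + φ) ≤ 0) ∧
      ∀ s ∈ Icc s₂ (s₁ + 2 * Real.pi), 0 ≤ K + a * Real.cos (s + φ) := by
  by_cases h1 : K ≤ -a
  · left
    intro s
    nlinarith [Real.cos_le_one (s + φ)]
  by_cases h2 : a ≤ K
  · right; left
    intro s
    nlinarith [Real.neg_one_le_cos (s + φ)]
  push Not at h1 h2
  have ha' : 0 < a := by linarith
  right; right
  set α := Real.arccos (-K / a) with hα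
  have hcos : Real.cos α = -K / a :=
    Real.cos_arccos (by rw [le_div_iff₀ ha']; linarith) (by rw [div_le_iff₀ ha']; linarith)
  have hK : K = - a * Real.cos α := by rw [hcos]; field_simp
  have hα0 : 0 ≤ α := Real.arccos_nonneg _
  have hα1 : α ≤ Real.pi := Real.arccos_le_pi _
  refine ⟨α - φ, 2 * Real.pi - α - φ, by linarith, by linarith, fun s hs => ?_, fun s hs => ?_⟩
  · have : Real.cos (s + φ) ≤ Real.cos α := by
      rcases le_total (s + φ) Real.pi with h | h
      · exact Real.cos_le_cos_of_nonneg_of_le_pi hα0 h (by linarith [hs.1])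
      · rw [← Real.cos_two_pi_sub (s + φ)]
        exact Real.cos_le_cos_of_nonneg_of_le_pi hα0 (by linarith) (by linarith [hs.2])
    rw [hK]; nlinarith
  · have : Real.cos α ≤ Real.cos (s + φ) := by
      rw [← Real.cos_sub_two_pi (s + φ), ← Real.cos_abs (s + φ - 2 * Real.pi)]
      refine Real.cos_le_cos_of_nonneg_of_le_pi (abs_nonneg _) hα1 (abs_le.mpr ⟨?_, ?_⟩)
      · linarith [hs.1]
      · linarith [hs.2]
    rw [hK]; nlinarith

/-- The difference of the squared moduli of two affine functions on a circle changes sign at most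
twice. -/
theorem circle_sign_regions (a₀ a₁ b₀ b₁ : ℂ) :
    let q : ℝ → ℝ := fun s => ‖a₀ + a₁ * Complex.exp (s * Complex.I)‖ ^ 2 -
      ‖b₀ + b₁ * Complex.exp (s * Complex.I)‖ ^ 2
    (∀ s, q s ≤ 0) ∨ (∀ s, 0 ≤ q s) ∨
      ∃ s₁ s₂, s₁ ≤ s₂ ∧ s₂ ≤ s₁ + 2 * Real.pi ∧
      (∀ s ∈ Icc s₁ s₂, q s ≤ 0) ∧ ∀ s ∈ Icc s₂ (s₁ + 2 * Real.pi), 0 ≤ q s := by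
  intro q
  have key : ∀ (a b : ℂ) (s : ℝ), ‖a + b * Complex.exp (s * Complex.I)‖ ^ 2 =
      ‖a‖ ^ 2 + ‖b‖ ^ 2 + 2 * (((starRingEnd ℂ) a * b).re * Real.cos s -
        ((starRingEnd ℂ) a * b).im * Real.sin s) := by
    intro a b s
    rw [Complex.sq_norm, Complex.sq_norm, Complex.sq_norm, Complex.normSq_apply,
      Complex.normSq_apply, Complex.normSq_apply, Complex.exp_mul_I, ← Complex.ofReal_cos,
      ← Complex.ofReal_sin]
    have hcs := Real.sin_sq_add_cos_sq s
    generalize Real.sin s = S at *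
    generalize Real.cos s = C at *
    simp
    linear_combination (b.re ^ 2 + b.im ^ 2) * hcs
  set L : ℂ := 2 * ((starRingEnd ℂ) a₀ * a₁ - (starRingEnd ℂ) b₀ * b₁) with hL
  have hq : q = fun s => (‖a₀‖ ^ 2 + ‖a₁‖ ^ 2 - ‖b₀‖ ^ 2 - ‖b₁‖ ^ 2) +
      ‖L‖ * Real.cos (s + L.arg) := by
    funext s
    simp only [q]
    rw [key, key, Real.cos_add]
    have e1 : ‖L‖ * Real.cos L.arg = L.re := Complex.norm_mul_cos_arg L
    have e2 : ‖L‖ * Real.sin L.arg = L.im := Complex.norm_mul_sin_arg L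
    have e3 : L.re = 2 * (((starRingEnd ℂ) a₀ * a₁).re - ((starRingEnd ℂ) b₀ * b₁).re) := by
      rw [hL]; simp
    have e4 : L.im = 2 * (((starRingEnd ℂ) a₀ * a₁).im - ((starRingEnd ℂ) b₀ * b₁).im) := by
      rw [hL]; simp
    linear_combination -Real.cos s * e1 + Real.sin s * e2 - Real.cos s * e3 + Real.sin s * e4
  rw [hq]
  exact trig_sign_regions _ _ _ (norm_nonneg L)

/-- The image of a disc containing `0` under a Möbius map fixing `0` which is finite on the
closed disc is star-shaped about `0`. -/
theorem star_ray_le {e κ γ w : ℂ} {r t t' : ℝ} (hγ : ‖γ‖ < r) (hr : r * ‖κ‖ ≤ ‖e + γ * κ‖)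
    (ht : 0 < t) (ht' : 0 < t')
    (h1 : ‖(e + γ * κ) * (t * w) - γ‖ ^ 2 - r ^ 2 * ‖1 - κ * (t * w)‖ ^ 2 ≤ 0)
    (h2 : 0 ≤ ‖(e + γ * κ) * (t' * w) - γ‖ ^ 2 - r ^ 2 * ‖1 - κ * (t' * w)‖ ^ 2) : t ≤ t' := by
  have hr0 : 0 < r := (norm_nonneg _).trans_lt hγ
  obtain ⟨β, hβ⟩ : ∃ β : ℝ, ∀ x : ℝ,
      ‖(e + γ * κ) * (x * w) - γ‖ ^ 2 - r ^ 2 * ‖1 - κ * (x * w)‖ ^ 2 =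
      (‖e + γ * κ‖ ^ 2 - (r * ‖κ‖) ^ 2) * ‖w‖ ^ 2 * x ^ 2 + β * x - (r ^ 2 - ‖γ‖ ^ 2) := by
    refine ⟨- 2 * ((starRingEnd ℂ) γ * ((e + γ * κ) * w)).re + 2 * r ^ 2 * (κ * w).re,
      fun x => ?_⟩
    simp only [mul_pow, Complex.sq_norm, Complex.normSq_apply]
    simp
    ring
  rw [hβ] at h1 h2
  by_contra! hlt
  have hα : 0 ≤ (‖e + γ * κ‖ ^ 2 - (r * ‖κ‖) ^ 2) * ‖w‖ ^ 2 := by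
    refine mul_nonneg (sub_nonneg.mpr ?_) (by positivity)
    exact pow_le_pow_left₀ (by positivity) hr 2
  have hC : 0 < r ^ 2 - ‖γ‖ ^ 2 := sub_pos.mpr (pow_lt_pow_left₀ hγ (norm_nonneg _) two_ne_zero)
  generalize (‖e + γ * κ‖ ^ 2 - (r * ‖κ‖) ^ 2) * ‖w‖ ^ 2 = α at *
  generalize r ^ 2 - ‖γ‖ ^ 2 = C at *
  have h3 := mul_nonpos_of_nonpos_of_nonneg h1 ht'.le
  have h4 := mul_nonneg h2 ht.le
  have h5 : 0 < (t - t') * (α * t * t' + C) := mul_pos (by linarith) (by positivity)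
  nlinarith

theorem mul_norm_le_of_ne_zero {e κ γ : ℂ} {r : ℝ}
    (h : ∀ x, ‖x - γ‖ ≤ r → e + κ * x ≠ 0) : r * ‖κ‖ ≤ ‖e + γ * κ‖ := by
  by_cases hκ : κ = 0
  · simp [hκ]
  by_contra! hlt
  refine h (-e / κ) ?_ (by field_simp; ring)
  have : -e / κ - γ = - (e + γ * κ) / κ := by field_simp; ring
  rw [this, norm_div, norm_neg, div_le_iff₀ (norm_pos_iff.mpr hκ)]
  exact hlt.le

theorem dist_lt_of_smul_mem_closedBall {c o x : ℂ} {r τ : ℝ} (ho : o ∈ ball c r) (hτ : 0 < τ)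
    (hτ1 : τ < 1) (h : o + (x - o) / τ ∈ closedBall c r) : dist x c < r := by
  have h1 : x - c = (1 - τ : ℝ) • (o - c) + τ • (o + (x - o) / τ - c) := by
    have : (τ : ℂ) ≠ 0 := by exact_mod_cast hτ.ne'
    simp only [Complex.real_smul]
    push_cast
    field_simp
    ring
  rw [dist_eq_norm, h1]
  refine (norm_add_le _ _).trans_lt ?_
  rw [norm_smul, norm_smul, Real.norm_of_nonneg (by linarith), Real.norm_of_nonneg hτ.le,
    ← dist_eq_norm, ← dist_eq_norm]
  have h2 : dist o c < r := ho
  have h3 := mem_closedBall.mp h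
  nlinarith

/-- Polar coordinates for a loop of winding number one which meets every ray from the origin at
most once. -/
theorem exists_polar {u : ℝ → ℂ} (hu : LoopWind u 1)
    (hinj : ∀ s t, u s = u t → ∃ k : ℤ, s = t + k * (2 * Real.pi))
    (hray : ∀ s t (w : ℂ) (x y : ℝ), 0 < x → 0 < y → u s = x * w → u t = y * w → x = y) :
    ∃ ρ Θ : ℝ → ℝ, Continuous ρ ∧ Continuous Θ ∧ (∀ s, 0 < ρ s) ∧
      (∀ s, ρ (s + 2 * Real.pi) = ρ s) ∧ (∀ s, Θ (s + 2 * Real.pi) = Θ s + 2 * Real.pi) ∧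
      Monotone Θ ∧ ∀ s, u s = ρ s * Complex.exp (Θ s * Complex.I) := by
  obtain ⟨H, hH, he, hp⟩ := hu
  have hΘp : ∀ s, (H (s + 2 * Real.pi)).im = (H s).im + 2 * Real.pi := fun s => by
    rw [hp]; simp
  have hrep : ∀ s, u s = (Real.exp (H s).re : ℝ) * Complex.exp ((H s).im * Complex.I) := fun s => by
    rw [he s, Complex.ofReal_exp, ← Complex.exp_add, Complex.re_add_im]
  have hΘ : Continuous fun s => (H s).im := by fun_prop
  have hΘi : Function.Injective fun s => (H s).im := by
    intro s t hst
    beta_reduce at hst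
    have h1 := hrep t
    rw [← hst] at h1
    have h2 := hray s t _ _ _ (Real.exp_pos _) (Real.exp_pos _) (hrep s) h1
    obtain ⟨k, hk⟩ := hinj s t (by rw [hrep s, h1, h2])
    have h3 : (H s).im = (H t).im + k * (2 * Real.pi) := by
      have h4 : ∀ n : ℤ, (H (t + n * (2 * Real.pi))).im - (n * (2 * Real.pi)) = (H t).im := by
        have : Function.Periodic (fun x => (H x).im - x) (2 * Real.pi) := fun x => by
          beta_reduce; rw [hΘp]; ring
        intro n
        have := this.int_mul n t
        beta_reduce at this
        linarith
      rw [hk]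
      linarith [h4 k]
    have h5 : (k : ℝ) * (2 * Real.pi) = 0 := by linarith
    rw [hk, h5, add_zero]
  have hm : Monotone fun s => (H s).im := by
    rcases hΘ.strictMono_of_inj hΘi with h | h
    · exact h.monotone
    · have h1 := h (show (0 : ℝ) < 0 + 2 * Real.pi by linarith [Real.pi_pos])
      beta_reduce at h1
      rw [hΘp] at h1
      linarith [Real.pi_pos]
  refine ⟨fun s => Real.exp (H s).re, fun s => (H s).im, by fun_prop, hΘ, fun s => Real.exp_pos _,
    fun s => ?_, hΘp, hm, hrep⟩
  beta_reduce
  rw [hp]; simp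

/-- Squared radius relation for the image of a circle under a Möbius map fixing the origin. -/
theorem moebius_form_eq {e κ γ x : ℂ} {r : ℝ} (hN : e + κ * x ≠ 0) :
    ‖(e + γ * κ) * (x / (e + κ * x)) - γ‖ ^ 2 - r ^ 2 * ‖1 - κ * (x / (e + κ * x))‖ ^ 2 =
      ‖e‖ ^ 2 * (‖x - γ‖ ^ 2 - r ^ 2) / ‖e + κ * x‖ ^ 2 := by
  have h1 : (e + γ * κ) * (x / (e + κ * x)) - γ = e * (x - γ) / (e + κ * x) := by
    field_simp; ring
  have h2 : 1 - κ * (x / (e + κ * x)) = e / (e + κ * x) := by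
    field_simp; ring
  have := norm_pos_iff.mpr hN
  rw [h1, h2, norm_div, norm_div, norm_mul]
  field_simp

theorem moebius_injective {e κ x y : ℂ} (he : e ≠ 0) (hx : e + κ * x ≠ 0) (hy : e + κ * y ≠ 0)
    (h : x / (e + κ * x) = y / (e + κ * y)) : x = y := by
  rw [div_eq_div_iff hx hy] at h
  exact mul_left_cancel₀ he (by linear_combination h)

theorem circle_index_of_factor {g : ℂ → ℂ} {c₀ c₁ o o' e κ e' κ' : ℂ} {r r₁ : ℝ}
    (hg : ContinuousOn g (sphere c₀ r)) (hm : ∀ x ∈ sphere c₀ r, g x ∈ sphere c₁ r₁)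
    (hinj : InjOn g (sphere c₀ r)) (ho : o ∈ ball c₀ r) (ho' : o' ∈ ball c₁ r₁)
    (hw : HasWind (fun x => g x - o') c₀ r 1) (he : e ≠ 0) (he' : e' ≠ 0)
    (hN : ∀ x ∈ closedBall c₀ r, e + κ * (x - o) ≠ 0)
    (hN' : ∀ x ∈ closedBall c₁ r₁, e' + κ' * (x - o') ≠ 0)
    (hW : ∀ x ∈ sphere c₀ r,
      (g x - o') * (e + κ * (x - o)) - (x - o) * (e' + κ' * (g x - o')) ≠ 0) :
    ∃ k : ℤ, 0 ≤ k ∧ HasWind (fun x =>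
      (g x - o') * (e + κ * (x - o)) - (x - o) * (e' + κ' * (g x - o'))) c₀ r k := by
  have hr : 0 < r := dist_nonneg.trans_lt ho
  have hr₁ : 0 < r₁ := dist_nonneg.trans_lt ho'
  have hz : ∀ s, circleMap c₀ r s ∈ sphere c₀ r := circleMap_mem_sphere c₀ hr.le
  have hzb : ∀ s, circleMap c₀ r s ∈ closedBall c₀ r := fun s => sphere_subset_closedBall (hz s)
  have hgb : ∀ s, g (circleMap c₀ r s) ∈ closedBall c₁ r₁ :=
    fun s => sphere_subset_closedBall (hm _ (hz s))
  set N : ℝ → ℂ := fun s => e + κ * (circleMap c₀ r s - o) with hNdef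
  set N' : ℝ → ℂ := fun s => e' + κ' * (g (circleMap c₀ r s) - o') with hN'def
  have hN0 : ∀ s, N s ≠ 0 := fun s => hN _ (hzb s)
  have hN0' : ∀ s, N' s ≠ 0 := fun s => hN' _ (hgb s)
  have wN : HasWind (fun x => e + κ * (x - o)) c₀ r 0 :=
    HasWind.of_closedBall hr.le (by fun_prop) hN
  have wN' : HasWind (fun x => e' + κ' * (g x - o')) c₀ r 0 :=
    HasWind.comp_closedBall (L := fun w => e' + κ' * (w - o')) hr.le (by fun_prop) hN' hg
      fun x hx => sphere_subset_closedBall (hm x hx)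
  have wu : HasWind (fun x => (x - o) / (e + κ * (x - o))) c₀ r 1 := by
    simpa using (HasWind.sub_interior ho).div wN
  have wv : HasWind (fun x => (g x - o') / (e' + κ' * (g x - o'))) c₀ r 1 := by
    simpa using hw.div wN'
  set u : ℝ → ℂ := fun s => (circleMap c₀ r s - o) / N s with hu
  set v : ℝ → ℂ := fun s => (g (circleMap c₀ r s) - o') / N' s with hv
  set γ := c₀ - o with hγ
  set γ' := c₁ - o' with hγ'
  have hγn : ‖γ‖ < r := by rw [hγ, ← dist_eq_norm, dist_comm]; exact ho
  have hγn' : ‖γ'‖ < r₁ := by rw [hγ', ← dist_eq_norm, dist_comm]; exact ho'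
  have hA : r * ‖κ‖ ≤ ‖e + γ * κ‖ := mul_norm_le_of_ne_zero fun x hx => by
    have := hN (x + o) (by
      rw [mem_closedBall_iff_norm, show x + o - c₀ = x - γ by rw [hγ]; ring]
      exact hx)
    simpa using this
  have hA' : r₁ * ‖κ'‖ ≤ ‖e' + γ' * κ'‖ := mul_norm_le_of_ne_zero fun x hx => by
    have := hN' (x + o') (by
      rw [mem_closedBall_iff_norm, show x + o' - c₁ = x - γ' by rw [hγ']; ring]
      exact hx)
    simpa using this
  have hQu : ∀ s, ‖(e + γ * κ) * u s - γ‖ ^ 2 - r ^ 2 * ‖1 - κ * u s‖ ^ 2 = 0 := fun s => by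
    rw [hu]; simp only
    rw [moebius_form_eq (hN0 s)]
    have : ‖circleMap c₀ r s - o - γ‖ = r := by
      have h := mem_sphere_iff_norm.mp (hz s)
      rwa [show circleMap c₀ r s - o - γ = circleMap c₀ r s - c₀ by rw [hγ]; ring]
    rw [this]; simp
  have hQv : ∀ s, ‖(e' + γ' * κ') * v s - γ'‖ ^ 2 - r₁ ^ 2 * ‖1 - κ' * v s‖ ^ 2 = 0 := fun s => by
    rw [hv]; simp only
    rw [moebius_form_eq (hN0' s)]
    have : ‖g (circleMap c₀ r s) - o' - γ'‖ = r₁ := by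
      have h := mem_sphere_iff_norm.mp (hm _ (hz s))
      rwa [show g (circleMap c₀ r s) - o' - γ' = g (circleMap c₀ r s) - c₁ by rw [hγ']; ring]
    rw [this]; simp
  obtain ⟨ρ, Θ, hρc, hΘc, hρ, hρp, hΘp, hΘm, hue⟩ := exists_polar (u := u) wu
    (fun s t hst => circleMap_eq_imp hr.ne' s t
      (sub_left_injective (moebius_injective he (hN0 s) (hN0 t) hst)))
    (fun s t w x y hx hy hs ht => by
      have h1 := hQu s
      have h2 := hQu t
      rw [hs] at h1
      rw [ht] at h2
      exact le_antisymm (star_ray_le hγn hA hx hy h1.le h2.ge)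
        (star_ray_le hγn hA hy hx h2.le h1.ge))
  obtain ⟨ρ', Φ, hρc', hΦc, hρ', hρp', hΦp, hΦm, hve⟩ := exists_polar (u := v) wv
    (fun s t hst => circleMap_eq_imp hr.ne' s t
      (hinj (hz s) (hz t) (sub_left_injective (moebius_injective he' (hN0' s) (hN0' t) hst))))
    (fun s t w x y hx hy hs ht => by
      have h1 := hQv s
      have h2 := hQv t
      rw [hs] at h1
      rw [ht] at h2
      exact le_antisymm (star_ray_le hγn' hA' hx hy h1.le h2.ge)
        (star_ray_le hγn' hA' hy hx h2.le h1.ge))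
  have hfac : ∀ s, (g (circleMap c₀ r s) - o') * N s - (circleMap c₀ r s - o) * N' s =
      N s * N' s * (v s - u s) := fun s => by
    have h1 := hN0 s
    have h2 := hN0' s
    simp only [hu, hv]
    field_simp
  have hvu : ∀ s, v s - u s ≠ 0 := fun s h => by
    refine hW _ (hz s) ((hfac s).trans ?_)
    rw [h, mul_zero]
  set a₀ := (e' + γ' * κ') * γ - γ' * (e + κ * γ) with ha₀
  set a₁ := ((e' + γ' * κ') - γ' * κ) * r with ha₁
  set b₀ := r₁ * (e + κ * γ - κ' * γ) with hb₀
  set b₁ := r₁ * (κ - κ') * r with hb₁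
  have hq : ∀ s : ℝ, ‖a₀ + a₁ * Complex.exp (s * Complex.I)‖ ^ 2 -
      ‖b₀ + b₁ * Complex.exp (s * Complex.I)‖ ^ 2 =
      ‖N s‖ ^ 2 * (‖(e' + γ' * κ') * u s - γ'‖ ^ 2 - r₁ ^ 2 * ‖1 - κ' * u s‖ ^ 2) := fun s => by
    have h1 := hN0 s
    have e1 : a₀ + a₁ * Complex.exp (s * Complex.I) = N s * ((e' + γ' * κ') * u s - γ') := by
      rw [hu]; simp only
      rw [mul_sub, mul_left_comm, mul_div_cancel₀ _ h1]
      simp only [hNdef, circleMap, ha₀, ha₁, hγ]; ring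
    have e2 : b₀ + b₁ * Complex.exp (s * Complex.I) = r₁ * (N s * (1 - κ' * u s)) := by
      rw [hu]; simp only
      rw [mul_sub, mul_left_comm (N s), mul_div_cancel₀ _ h1]
      simp only [hNdef, circleMap, hb₀, hb₁, hγ]; ring
    rw [e1, e2, norm_mul, norm_mul, norm_mul, Complex.norm_real, Real.norm_of_nonneg hr₁.le]
    ring
  have hNpos : ∀ s, 0 < ‖N s‖ ^ 2 := fun s => pow_pos (norm_pos_iff.mpr (hN0 s)) 2
  have hexp : ∀ s (k : ℤ), Φ s - Θ s = k * (2 * Real.pi) →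
      Complex.exp (Φ s * Complex.I) = Complex.exp (Θ s * Complex.I) := fun s k hk => by
    rw [Complex.exp_eq_exp_iff_exists_int]
    refine ⟨k, ?_⟩
    have : Φ s = Θ s + k * (2 * Real.pi) := by linarith
    rw [this]; push_cast; ring
  obtain ⟨k, hk0, hk⟩ := star_index hρc hρc' hΘc hΦc hρ hρ' hρp hρp' hΘp hΦp hΘm hΦm
    (fun s => by rw [← hue, ← hve]; exact hvu s)
    (q := fun s => ‖a₀ + a₁ * Complex.exp (s * Complex.I)‖ ^ 2 -
      ‖b₀ + b₁ * Complex.exp (s * Complex.I)‖ ^ 2)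
    (fun s hs k hk => by
      rw [hq] at hs
      replace hs := nonpos_of_mul_nonpos_right hs (hNpos s)
      rw [hue] at hs
      have h2 := hQv s
      rw [hve, hexp s k hk] at h2
      refine (star_ray_le hγn' hA' (hρ s) (hρ' s) hs h2.ge).lt_of_ne fun h => hvu s ?_
      rw [hve, hue, hexp s k hk, h, sub_self])
    (fun s hs k hk => by
      rw [hq, mul_nonneg_iff_of_pos_left (hNpos s), hue] at hs
      have h2 := hQv s
      rw [hve, hexp s k hk] at h2
      refine (star_ray_le hγn' hA' (hρ' s) (hρ s) h2.le hs).lt_of_ne fun h => hvu s ?_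
      rw [hve, hue, hexp s k hk, h, sub_self])
    (circle_sign_regions a₀ a₁ b₀ b₁)
  refine ⟨k, hk0, ?_⟩
  have h3 := (LoopWind.mul wN wN').mul hk
  rw [zero_add, zero_add] at h3
  refine h3.congr fun s => ?_
  rw [← hue, ← hve]
  exact (hfac s).symm

/-- The Möbius incidence function has nonnegative winding number along a circle which is mapped
homeomorphically, with positive orientation, onto a circle. -/
theorem circle_index {g : ℂ → ℂ} {c₀ c₁ : ℂ} {r r₁ : ℝ} (hr : 0 < r)
    (hg : ContinuousOn g (sphere c₀ r)) (hm : ∀ x ∈ sphere c₀ r, g x ∈ sphere c₁ r₁)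
    (hinj : InjOn g (sphere c₀ r))
    (hw : ∀ o ∈ ball c₁ r₁, HasWind (fun x => g x - o) c₀ r 1) {a b c d : ℂ}
    (hΔ : a * d - b * c ≠ 0)
    (hW : ∀ x ∈ sphere c₀ r, c * x * g x + d * g x - a * x - b ≠ 0) :
    ∃ k : ℤ, 0 ≤ k ∧ HasWind (fun x => c * x * g x + d * g x - a * x - b) c₀ r k := by
  have hz : ∀ s, circleMap c₀ r s ∈ sphere c₀ r := circleMap_mem_sphere c₀ hr.le
  have hgc : Continuous fun s => g (circleMap c₀ r s) :=
    hg.comp_continuous (continuous_circleMap c₀ r) hz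
  by_cases hex : ∃ o ∈ ball c₀ r, ∃ o' ∈ ball c₁ r₁, c * o * o' + d * o' - a * o - b = 0
  · obtain ⟨o, ho, o', ho', hoo⟩ := hex
    obtain ⟨e, he⟩ : ∃ e, e = c * o + d := ⟨_, rfl⟩
    obtain ⟨e', he'⟩ : ∃ e', e' = a - c * o' := ⟨_, rfl⟩
    have hee : e * e' = a * d - b * c := by
      rw [he, he']; linear_combination -c * hoo
    have he0 : e ≠ 0 := left_ne_zero_of_mul (hee ▸ hΔ)
    have he0' : e' ≠ 0 := right_ne_zero_of_mul (hee ▸ hΔ)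
    have hWe : ∀ x w, c * x * w + d * w - a * x - b =
        c * (x - o) * (w - o') + e * (w - o') - e' * (x - o) := fun x w => by
      rw [he, he']; linear_combination hoo
    by_cases hl : ∃ l : ℂ, (∀ x ∈ closedBall c₀ r, e + (c - l) * (x - o) ≠ 0) ∧
        ∀ x ∈ closedBall c₁ r₁, e' + (-l) * (x - o') ≠ 0
    · obtain ⟨l, hl1, hl2⟩ := hl
      have hWf : ∀ x w, (w - o') * (e + (c - l) * (x - o)) - (x - o) * (e' + (-l) * (w - o')) =
          c * x * w + d * w - a * x - b := fun x w => by rw [hWe]; ring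
      obtain ⟨k, hk0, hk⟩ := circle_index_of_factor hg hm hinj ho ho' (hw o' ho') he0 he0' hl1 hl2
        (fun x hx => by rw [hWf]; exact hW x hx)
      exact ⟨k, hk0, hk.congr hr.le fun x _ => hWf x (g x)⟩
    · push Not at hl
      have hx0 : ∀ s, circleMap c₀ r s - o ≠ 0 := fun s h => by
        have := mem_sphere.mp (hz s)
        rw [sub_eq_zero.mp h] at this
        exact (mem_ball.mp ho).ne this
      have hy0 : ∀ s, g (circleMap c₀ r s) - o' ≠ 0 := fun s h => by
        have := mem_sphere.mp (hm _ (hz s))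
        rw [sub_eq_zero.mp h] at this
        exact (mem_ball.mp ho').ne this
      have hc0 : c ≠ 0 := by
        rintro rfl
        obtain ⟨x, -, hx⟩ := hl 0 (fun x _ => by simpa using he0)
        simp at hx
        exact he0' hx
      have hVW : ∀ s, c * circleMap c₀ r s * g (circleMap c₀ r s) + d * g (circleMap c₀ r s) -
          a * circleMap c₀ r s - b = (circleMap c₀ r s - o) * (g (circleMap c₀ r s) - o') *
          (c + ((1 : ℝ) : ℂ) * (e / (circleMap c₀ r s - o) - e' / (g (circleMap c₀ r s) - o'))) :=
          fun s => by
        rw [hWe]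
        have h1 := hx0 s
        have h2 := hy0 s
        field_simp
        push_cast; ring
      have hV : LoopWind (fun s => c + ((1 : ℝ) : ℂ) * (e / (circleMap c₀ r s - o) -
          e' / (g (circleMap c₀ r s) - o'))) 0 := by
        refine LoopWind.of_homotopy (Γ := fun t s => c + (t : ℂ) * (e / (circleMap c₀ r s - o) -
          e' / (g (circleMap c₀ r s) - o'))) ?_ ?_ ?_ ?_
        · refine Continuous.continuousOn (continuous_const.add
            ((Complex.continuous_ofReal.comp continuous_fst).mul ?_))
          have h1 : Continuous fun s => e / (circleMap c₀ r s - o) -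
              e' / (g (circleMap c₀ r s) - o') :=
            (continuous_const.div ((continuous_circleMap c₀ r).sub continuous_const) hx0).sub
              (continuous_const.div (hgc.sub continuous_const) hy0)
          exact h1.comp continuous_snd
        · intro t ht s h0
          rcases ht.1.eq_or_lt with rfl | ht0
          · exact hc0 (by simpa using h0)
          rcases ht.2.eq_or_lt with rfl | ht1
          · exact hW _ (hz s) ((hVW s).trans (by rw [h0, mul_zero]))
          have htc : (t : ℂ) ≠ 0 := by exact_mod_cast ht0.ne'
          have h1 := hx0 s
          have h2 := hy0 s
          have hl0 : c + t * e / (circleMap c₀ r s - o) = t * e' / (g (circleMap c₀ r s) - o') := by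
            linear_combination h0
          obtain ⟨y, hy, hy0⟩ := hl (c + t * e / (circleMap c₀ r s - o)) (fun x hx h3 => by
            have h4 : x = o + (circleMap c₀ r s - o) / t := by
              field_simp at h3
              rw [eq_comm, ← sub_eq_zero]
              field_simp
              have h5 : e * ((circleMap c₀ r s - o) - t * (x - o)) = 0 := by
                linear_combination h3
              linear_combination (mul_eq_zero.mp h5).resolve_left he0
            rw [h4] at hx
            exact (dist_lt_of_smul_mem_closedBall ho ht0 ht1 hx).ne (hz s))
          rw [hl0] at hy0
          have h4 : y = o' + (g (circleMap c₀ r s) - o') / t := by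
            field_simp at hy0
            rw [eq_comm, ← sub_eq_zero]
            field_simp
            have h5 : e' * ((g (circleMap c₀ r s) - o') - t * (y - o')) = 0 := by
              linear_combination hy0
            linear_combination (mul_eq_zero.mp h5).resolve_left he0'
          rw [h4] at hy
          exact (dist_lt_of_smul_mem_closedBall ho' ht0 ht1 hy).ne (hm _ (hz s))
        · intro t _ s
          rw [circleMap_add_two_pi]
        · intro s; simp
      have h2 := ((HasWind.sub_interior ho).mul (hw o' ho'))
      refine ⟨2, by norm_num, ?_⟩
      exact (LoopWind.mul h2 hV).congr fun s => (hVW s).symm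
  · push Not at hex
    have hr₁ : 0 ≤ r₁ := dist_nonneg.trans_eq (hm _ (hz 0))
    refine ⟨0, le_rfl, ?_⟩
    obtain ⟨Γ, hΓ⟩ : ∃ Γ : ℝ → ℝ → ℂ, Γ = fun (t s : ℝ) =>
        c * (c₀ + (t : ℂ) * (circleMap c₀ r s - c₀)) *
        (c₁ + t * (g (circleMap c₀ r s) - c₁)) + d * (c₁ + t * (g (circleMap c₀ r s) - c₁)) -
        a * (c₀ + t * (circleMap c₀ r s - c₀)) - b := ⟨_, rfl⟩
    have key : LoopWind (Γ 1) 0 := by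
      subst hΓ
      refine LoopWind.of_homotopy (Γ := fun t s => c * (c₀ + t * (circleMap c₀ r s - c₀)) *
        (c₁ + t * (g (circleMap c₀ r s) - c₁)) + d * (c₁ + t * (g (circleMap c₀ r s) - c₁)) -
        a * (c₀ + t * (circleMap c₀ r s - c₀)) - b) ?_ ?_ ?_ ?_
      · have h1 : Continuous fun x : ℝ × ℝ => c₀ + (x.1 : ℂ) * (circleMap c₀ r x.2 - c₀) :=
          continuous_const.add ((Complex.continuous_ofReal.comp continuous_fst).mul
            (((continuous_circleMap c₀ r).comp continuous_snd).sub continuous_const))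
        have h2 : Continuous fun x : ℝ × ℝ => c₁ + (x.1 : ℂ) * (g (circleMap c₀ r x.2) - c₁) :=
          continuous_const.add ((Complex.continuous_ofReal.comp continuous_fst).mul
            ((hgc.comp continuous_snd).sub continuous_const))
        exact ((((continuous_const.mul h1).mul h2).add (continuous_const.mul h2)).sub
          (continuous_const.mul h1)).sub continuous_const |>.continuousOn
      · intro t ht s
        rcases ht.2.eq_or_lt with rfl | ht1
        · rw [Complex.ofReal_one, one_mul, one_mul, add_sub_cancel, add_sub_cancel]
          exact hW _ (hz s)
        have hin : ∀ {C y : ℂ} {ρ : ℝ}, 0 < ρ → y ∈ sphere C ρ → C + t * (y - C) ∈ ball C ρ := by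
          intro C y ρ hρ hy
          rw [mem_ball_iff_norm, add_sub_cancel_left, norm_mul, mem_sphere_iff_norm.mp hy,
            Complex.norm_real, Real.norm_of_nonneg ht.1]
          nlinarith
        rcases hr₁.eq_or_lt with h0 | h0
        · exfalso
          have h1 := hm _ (hz 0)
          have h2 := hm _ (hz Real.pi)
          rw [← h0, sphere_zero, mem_singleton_iff] at h1 h2
          have h3 := hinj (hz 0) (hz Real.pi) (h1.trans h2.symm)
          obtain ⟨n, hn⟩ := circleMap_eq_imp hr.ne' _ _ h3
          have h4 : Real.pi * (1 + 2 * n) = 0 := by linarith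
          have h5 := (mul_eq_zero.mp h4).resolve_left Real.pi_ne_zero
          have h6 : (1 + 2 * n : ℤ) = 0 := by exact_mod_cast h5
          omega
        · exact hex _ (hin hr (hz s)) _ (hin h0 (hm _ (hz s)))
      · intro t _ s
        rw [circleMap_add_two_pi]
      · intro s; simp
    refine key.congr fun s => ?_
    rw [hΓ]
    beta_reduce
    rw [Complex.ofReal_one, one_mul, one_mul, add_sub_cancel, add_sub_cancel]

theorem closure_sdiff_closedBalls {ι : Type*} [Finite ι] {Ω : Set ℂ} (hΩ : IsOpen Ω) {c : ι → ℂ}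
    {r : ι → ℝ} (h : IsSchottkyFamily Ω c r) :
    closure (Ω \ ⋃ i, closedBall (c i) (r i)) = closure Ω \ ⋃ i, ball (c i) (r i) := by
  have hK : IsClosed (closure Ω \ ⋃ i, ball (c i) (r i)) :=
    isClosed_closure.sdiff (isOpen_iUnion fun i => isOpen_ball)
  refine (closure_minimal (sdiff_closedBalls_subset c r) hK).antisymm fun x hx => ?_
  by_cases hxA : x ∈ Ω \ ⋃ i, closedBall (c i) (r i)
  · exact subset_closure hxA
  rcases mem_frontier_or_sphere hΩ hx hxA with h1 | ⟨i, h1⟩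
  · have hV : IsOpen (⋃ i, closedBall (c i) (r i))ᶜ :=
      (isClosed_iUnion_of_finite fun i => isClosed_closedBall).isOpen_compl
    refine closure_mono ?_ (hV.inter_closure ⟨?_, hx.1⟩)
    · rintro y ⟨hy1, hy2⟩
      exact ⟨hy2, hy1⟩
    · intro hx'
      obtain ⟨i, hi⟩ := mem_iUnion.mp hx'
      exact frontier_notMem hΩ h1 (h.subset i hi)
  · have hV : IsOpen (Ω ∩ (⋃ j : {j // j ≠ i}, closedBall (c j) (r j))ᶜ) :=
      hΩ.inter (isClosed_iUnion_of_finite fun i => isClosed_closedBall).isOpen_compl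
    have h2 : x ∈ closure (closedBall (c i) (r i))ᶜ := by
      rw [← frontier_closedBall _ (h.pos i).ne', frontier_eq_closure_inter_closure] at h1
      exact h1.2
    refine closure_mono ?_ (hV.inter_closure ⟨⟨h.subset i (sphere_subset_closedBall h1), ?_⟩, h2⟩)
    · rintro y ⟨⟨hy1, hy2⟩, hy3⟩
      refine ⟨hy1, fun hy4 => ?_⟩
      obtain ⟨j, hj⟩ := mem_iUnion.mp hy4
      by_cases hji : j = i
      · exact hy3 (hji ▸ hj)
      · exact hy2 (mem_iUnion.mpr ⟨⟨j, hji⟩, hj⟩)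
    · intro hx'
      obtain ⟨⟨j, hji⟩, hj⟩ := mem_iUnion.mp hx'
      exact disjoint_left.mp (h.disjoint hji) hj (sphere_subset_closedBall h1)

/-- A homeomorphism between the closures of two relative circle domains, conformal on the
interior, mapping outer boundary to outer boundary and the peripheral circle with index `i` to the
one with index `σ i`. -/
structure IsCircleDomainMap {ι ι' : Type*} (Ω Ω' : Set ℂ) (z : ι → ℂ) (R : ι → ℝ) (z' : ι' → ℂ)
    (R' : ι' → ℝ) (σ : ι → ι') (g : ℂ → ℂ) : Prop where
  isOpen : IsOpen Ω
  isPreconnected : IsPreconnected Ω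
  isBounded : Bornology.IsBounded Ω
  family : IsSchottkyFamily Ω z R
  isOpen' : IsOpen Ω'
  isPreconnected' : IsPreconnected Ω'
  isBounded' : Bornology.IsBounded Ω'
  family' : IsSchottkyFamily Ω' z' R'
  continuousOn : ContinuousOn g (closure Ω \ ⋃ i, ball (z i) (R i))
  injOn : InjOn g (closure Ω \ ⋃ i, ball (z i) (R i))
  differentiableOn : DifferentiableOn ℂ g (Ω \ ⋃ i, closedBall (z i) (R i))
  deriv_ne_zero : ∀ w ∈ Ω \ ⋃ i, closedBall (z i) (R i), deriv g w ≠ 0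
  mapsTo : MapsTo g (closure Ω \ ⋃ i, ball (z i) (R i)) (closure Ω' \ ⋃ i, ball (z' i) (R' i))
  image_frontier : g '' frontier Ω = frontier Ω'
  image_sphere : ∀ i, g '' sphere (z i) (R i) = sphere (z' (σ i)) (R' (σ i))

namespace IsCircleDomainMap

variable {ι ι' : Type*} {Ω Ω' : Set ℂ} {z : ι → ℂ} {R : ι → ℝ} {z' : ι' → ℂ}
    {R' : ι' → ℝ} {σ : ι → ι'} {g : ℂ → ℂ}

theorem frontier_subset (h : IsCircleDomainMap Ω Ω' z R z' R' σ g) :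
    frontier Ω ⊆ closure Ω \ ⋃ i, ball (z i) (R i) := fun x hx => by
  refine ⟨frontier_subset_closure hx, fun hx' => ?_⟩
  obtain ⟨i, hi⟩ := mem_iUnion.mp hx'
  exact frontier_notMem h.isOpen hx (h.family.subset i (ball_subset_closedBall hi))

theorem sphere_subset (h : IsCircleDomainMap Ω Ω' z R z' R' σ g) (i : ι) :
    sphere (z i) (R i) ⊆ closure Ω \ ⋃ i, ball (z i) (R i) := fun x hx => by
  refine ⟨subset_closure (h.family.subset i (sphere_subset_closedBall hx)), fun hx' => ?_⟩
  obtain ⟨j, hj⟩ := mem_iUnion.mp hx'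
  by_cases hji : j = i
  · subst hji
    exact (mem_ball.mp hj).ne hx
  · exact disjoint_left.mp (h.family.disjoint hji) (ball_subset_closedBall hj)
      (sphere_subset_closedBall hx)

theorem injective (h : IsCircleDomainMap Ω Ω' z R z' R' σ g) : Function.Injective σ := by
  intro i j hij
  by_contra hne
  obtain ⟨x, hx⟩ := NormedSpace.sphere_nonempty (x := z i) |>.mpr (h.family.pos i).le
  have h1 : g x ∈ sphere (z' (σ j)) (R' (σ j)) := hij ▸ h.image_sphere i ▸ mem_image_of_mem g hx
  rw [← h.image_sphere j] at h1
  obtain ⟨y, hy, hxy⟩ := h1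
  rw [h.injOn (h.sphere_subset j hy) (h.sphere_subset i hx) hxy] at hy
  exact disjoint_left.mp (h.family.disjoint hne) (sphere_subset_closedBall hx)
    (sphere_subset_closedBall hy)

theorem mem_frontier (h : IsCircleDomainMap Ω Ω' z R z' R' σ g) {x : ℂ} (hx : x ∈ frontier Ω) :
    g x ∈ frontier Ω' := h.image_frontier ▸ mem_image_of_mem g hx

theorem mem_sphere (h : IsCircleDomainMap Ω Ω' z R z' R' σ g) {i : ι} {x : ℂ}
    (hx : x ∈ sphere (z i) (R i)) : g x ∈ sphere (z' (σ i)) (R' (σ i)) :=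
  h.image_sphere i ▸ mem_image_of_mem g hx

theorem mapsTo_interior [Finite ι] (h : IsCircleDomainMap Ω Ω' z R z' R' σ g) :
    MapsTo g (Ω \ ⋃ i, closedBall (z i) (R i)) (Ω' \ ⋃ i, closedBall (z' i) (R' i)) := by
  intro x hx
  have hAo := isOpen_sdiff_closedBalls h.isOpen z R
  have han : AnalyticAt ℂ g x := h.differentiableOn.analyticOnNhd hAo x hx
  have hmap := han.hasStrictDerivAt.map_nhds_eq (h.deriv_ne_zero x hx)
  have hgi : g x ∈ interior (closure Ω' \ ⋃ i, ball (z' i) (R' i)) := by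
    rw [mem_interior_iff_mem_nhds, ← hmap]
    exact mem_map.mpr (mem_of_superset (hAo.mem_nhds hx)
      fun y hy => h.mapsTo (sdiff_closedBalls_subset z R hy))
  by_contra hgA
  rcases mem_frontier_or_sphere h.isOpen' (interior_subset hgi) hgA with h1 | ⟨j, h1⟩
  · rw [← h.image_frontier] at h1
    obtain ⟨y, hy, hxy⟩ := h1
    rw [h.injOn (h.frontier_subset hy) (sdiff_closedBalls_subset z R hx) hxy] at hy
    exact frontier_notMem h.isOpen hy hx.1
  · have h2 : g x ∈ closure (ball (z' j) (R' j)) := by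
      rw [closure_ball _ (h.family'.pos j).ne']
      exact sphere_subset_closedBall h1
    obtain ⟨y, hy1, hy2⟩ := mem_closure_iff.mp h2 _ isOpen_interior hgi
    exact (interior_subset hy1).2 (mem_iUnion.mpr ⟨j, hy2⟩)

theorem exists_of_isHomeoOn [Finite ι] [Finite ι'] (hΩ : IsJordanDomain Ω) (hΩ' : IsJordanDomain Ω')
    (hfam : IsSchottkyFamily Ω z R) (hfam' : IsSchottkyFamily Ω' z' R')
    (hg : IsHomeoOn g (closure (Ω \ ⋃ i, closedBall (z i) (R i)))
      (closure (Ω' \ ⋃ i, closedBall (z' i) (R' i))))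
    (hol : DifferentiableOn ℂ g (Ω \ ⋃ i, closedBall (z i) (R i)))
    (hder : ∀ w ∈ Ω \ ⋃ i, closedBall (z i) (R i), deriv g w ≠ 0)
    (hbd : g '' frontier Ω = frontier Ω')
    (hper : ∀ i, ∃ j, g '' sphere (z i) (R i) = sphere (z' j) (R' j)) :
    ∃ σ, IsCircleDomainMap Ω Ω' z R z' R' σ g := by
  choose σ hσ using hper
  rw [closure_sdiff_closedBalls hΩ.1.1 hfam, closure_sdiff_closedBalls hΩ'.1.1 hfam'] at hg
  obtain ⟨e, he⟩ := hg
  refine ⟨σ, hΩ.1.1, hΩ.1.2.isPreconnected, hΩ.2.1, hfam, hΩ'.1.1, hΩ'.1.2.isPreconnected, hΩ'.2.1,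
    hfam', ?_, ?_, hol, hder, ?_, hbd, hσ⟩
  · rw [continuousOn_iff_continuous_domRestrict]
    exact (continuous_subtype_val.comp e.continuous).congr he
  · intro x hx y hy hxy
    have := e.injective (Subtype.ext ((he ⟨x, hx⟩).trans (hxy.trans (he ⟨y, hy⟩).symm)))
    exact congrArg Subtype.val this
  · intro x hx
    rw [← he ⟨x, hx⟩]
    exact (e ⟨x, hx⟩).2

end IsCircleDomainMap

theorem IsSchottkyFamily.option {ι : Type*} {Ω : Set ℂ} {c : ι → ℂ} {r : ι → ℝ}
    (h : IsSchottkyFamily Ω c r) {p : ℂ} {ρ : ℝ} (hρ : 0 < ρ)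
    (hp : closedBall p ρ ⊆ Ω \ ⋃ i, closedBall (c i) (r i)) :
    IsSchottkyFamily Ω (fun o : Option ι => o.elim p c) fun o => o.elim ρ r := by
  have hd : ∀ i, Disjoint (closedBall p ρ) (closedBall (c i) (r i)) := fun i =>
    disjoint_left.mpr fun x hx hx' => (hp hx).2 (mem_iUnion.mpr ⟨i, hx'⟩)
  refine ⟨?_, ?_, ?_⟩
  · rintro (_ | i)
    exacts [hρ, h.pos i]
  · rintro (_ | i)
    exacts [fun x hx => (hp hx).1, h.subset i]
  · rintro (_ | i) (_ | j) hij
    · exact absurd rfl hij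
    · exact hd j
    · exact (hd i).symm
    · exact h.disjoint fun hh => hij (congrArg some hh)

theorem sum_wind_add_eq {ι : Type*} [Fintype ι] {Ω : Set ℂ} (hΩ : IsOpen Ω)
    (hb : Bornology.IsBounded Ω) {c : ι → ℂ} {r : ι → ℝ} (hfam : IsSchottkyFamily Ω c r)
    {p : ℂ} {ρ : ℝ} (hρ : 0 < ρ) (hp : closedBall p ρ ⊆ Ω \ ⋃ i, closedBall (c i) (r i))
    {F : ℂ → ℂ} (hF : ContinuousOn F ((closure Ω \ ⋃ i, ball (c i) (r i)) \ ball p ρ))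
    (h0 : ∀ x ∈ (closure Ω \ ⋃ i, ball (c i) (r i)) \ ball p ρ, F x ≠ 0)
    {k : ι → ℤ} (hk : ∀ i, HasWind F (c i) (r i) (k i)) {N : ℤ} (hN : HasWind F p ρ N) {j : ℤ}
    {h : ℂ → ℂ} (hh : ContinuousOn h (frontier Ω))
    (hJ : ∀ x ∈ frontier Ω, F x = Complex.exp (h x) * (x - p) ^ j) : N + ∑ i, k i = j := by
  have hsub : closure Ω \ ⋃ o : Option ι, ball (o.elim p c) (o.elim ρ r) ⊆
      (closure Ω \ ⋃ i, ball (c i) (r i)) \ ball p ρ := fun x hx => by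
    simp only [Set.mem_sdiff, mem_iUnion, Option.exists, Option.elim_none, Option.elim_some] at hx ⊢
    tauto
  have := sum_wind_eq hΩ hb (hfam.option hρ hp) (hF.mono hsub) (fun x hx => h0 x (hsub hx))
    (k := fun o => o.elim N k) (by rintro (_ | i); exacts [hN, hk i])
    (hp (mem_closedBall_self hρ.le)).1 hh hJ
  rwa [Fintype.sum_option] at this

theorem sum_wind_add_le {ι : Type*} [Fintype ι] {Ω : Set ℂ} (hΩ : IsOpen Ω)
    (hconn : IsPreconnected Ω)
    (hb : Bornology.IsBounded Ω) {c : ι → ℂ} {r : ι → ℝ} (hfam : IsSchottkyFamily Ω c r)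
    {p : ℂ} {ρ : ℝ} (hρ : 0 < ρ) (hp : closedBall p ρ ⊆ Ω \ ⋃ i, closedBall (c i) (r i))
    {F : ℂ → ℂ} (hF : ContinuousOn F (closure Ω \ ⋃ i, ball (c i) (r i)))
    (hFd : DifferentiableOn ℂ F (Ω \ ⋃ i, closedBall (c i) (r i)))
    {k : ι → ℤ} (hk : ∀ i, HasWind F (c i) (r i) (k i)) {N : ℤ} (hN : HasWind F p ρ N) {j : ℤ}
    {h : ℂ → ℂ} (hh : ContinuousOn h (frontier Ω))
    (hJ : ∀ x ∈ frontier Ω, F x = Complex.exp (h x) * (x - p) ^ j) : N + ∑ i, k i ≤ j := by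
  have hsub : closure Ω \ ⋃ o : Option ι, ball (o.elim p c) (o.elim ρ r) ⊆
      closure Ω \ ⋃ i, ball (c i) (r i) := fun x hx => by
    simp only [Set.mem_sdiff, mem_iUnion, Option.exists, Option.elim_none, Option.elim_some] at hx ⊢
    tauto
  have hsub' : Ω \ ⋃ o : Option ι, closedBall (o.elim p c) (o.elim ρ r) ⊆
      Ω \ ⋃ i, closedBall (c i) (r i) := fun x hx => by
    simp only [Set.mem_sdiff, mem_iUnion, Option.exists, Option.elim_none, Option.elim_some] at hx ⊢
    tauto
  have := sum_wind_le hΩ hconn hb (hfam.option hρ hp) (hF.mono hsub) (hFd.mono hsub')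
    (k := fun o => o.elim N k) (by rintro (_ | i); exacts [hN, hk i])
    (hp (mem_closedBall_self hρ.le)).1 hh hJ
  rwa [Fintype.sum_option] at this

namespace IsCircleDomainMap

variable {ι ι' : Type*} {Ω Ω' : Set ℂ} {z : ι → ℂ} {R : ι → ℝ} {z' : ι' → ℂ}
    {R' : ι' → ℝ} {σ : ι → ι'} {g : ℂ → ℂ}

theorem mem_nhds [Finite ι] (h : IsCircleDomainMap Ω Ω' z R z' R' σ g) {p : ℂ}
    (hp : p ∈ Ω \ ⋃ i, closedBall (z i) (R i)) :
    closure Ω \ ⋃ i, ball (z i) (R i) ∈ 𝓝 p :=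
  mem_of_superset ((isOpen_sdiff_closedBalls h.isOpen z R).mem_nhds hp)
    (sdiff_closedBalls_subset z R)

theorem differentiableAt [Finite ι] (h : IsCircleDomainMap Ω Ω' z R z' R' σ g) {p : ℂ}
    (hp : p ∈ Ω \ ⋃ i, closedBall (z i) (R i)) : DifferentiableAt ℂ g p :=
  (h.differentiableOn p hp).differentiableAt ((isOpen_sdiff_closedBalls h.isOpen z R).mem_nhds hp)

theorem continuousOn_dslope [Finite ι] (h : IsCircleDomainMap Ω Ω' z R z' R' σ g) {p : ℂ}
    (hp : p ∈ Ω \ ⋃ i, closedBall (z i) (R i)) :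
    ContinuousOn (dslope g p) (closure Ω \ ⋃ i, ball (z i) (R i)) :=
  (_root_.continuousOn_dslope (h.mem_nhds hp)).mpr ⟨h.continuousOn, h.differentiableAt hp⟩

theorem differentiableOn_dslope [Finite ι] (h : IsCircleDomainMap Ω Ω' z R z' R' σ g) {p : ℂ}
    (hp : p ∈ Ω \ ⋃ i, closedBall (z i) (R i)) :
    DifferentiableOn ℂ (dslope g p) (Ω \ ⋃ i, closedBall (z i) (R i)) :=
  (Complex.differentiableOn_dslope
    ((isOpen_sdiff_closedBalls h.isOpen z R).mem_nhds hp)).mpr h.differentiableOn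

theorem dslope_ne_zero (h : IsCircleDomainMap Ω Ω' z R z' R' σ g) {p : ℂ}
    (hp : p ∈ Ω \ ⋃ i, closedBall (z i) (R i)) {x : ℂ}
    (hx : x ∈ closure Ω \ ⋃ i, ball (z i) (R i)) : dslope g p x ≠ 0 := by
  by_cases hxp : x = p
  · rw [hxp, dslope_same]
    exact h.deriv_ne_zero p hp
  · rw [dslope_of_ne _ hxp, slope_def_field]
    exact div_ne_zero (sub_ne_zero.mpr fun hg =>
      hxp (h.injOn hx (sdiff_closedBalls_subset z R hp) hg)) (sub_ne_zero.mpr hxp)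

theorem sub_eq_mul_dslope (g : ℂ → ℂ) (p x : ℂ) : g x - g p = (x - p) * dslope g p x := by
  simpa using (sub_smul_dslope g p x).symm

theorem notMem_closedBall {p : ℂ} (hp : p ∈ Ω \ ⋃ i, closedBall (z i) (R i)) (i : ι) :
    p ∉ closedBall (z i) (R i) :=
  fun hx => hp.2 (mem_iUnion.mpr ⟨_, hx⟩)

theorem hasWind_comp (h : IsCircleDomainMap Ω Ω' z R z' R' σ g) {i : ι} {L : ℂ → ℂ}
    (hL : ContinuousOn L (closedBall (z' (σ i)) (R' (σ i))))
    (h0 : ∀ x ∈ closedBall (z' (σ i)) (R' (σ i)), L x ≠ 0) :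
    HasWind (fun x => L (g x)) (z i) (R i) 0 :=
  HasWind.comp_closedBall (h.family.pos i).le hL h0 (h.continuousOn.mono (h.sphere_subset i))
    fun _ hx => sphere_subset_closedBall (h.mem_sphere hx)

/-- Peripheral circles are mapped with positive orientation. -/
theorem hasWind_sphere [Finite ι] (h : IsCircleDomainMap Ω Ω' z R z' R' σ g)
    (hne : (Ω \ ⋃ i, closedBall (z i) (R i)).Nonempty) {i : ι} {o : ℂ}
    (ho : o ∈ ball (z' (σ i)) (R' (σ i))) : HasWind (fun x => g x - o) (z i) (R i) 1 := by
  classical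
  cases nonempty_fintype ι
  obtain ⟨p, hp⟩ := hne
  have hAo := isOpen_sdiff_closedBalls h.isOpen z R
  obtain ⟨ρ, hρ, hball⟩ := nhds_basis_closedBall.mem_iff.mp (hAo.mem_nhds hp)
  have hballK := hball.trans (sdiff_closedBalls_subset z R)
  have hgo : ∀ x ∈ closure Ω \ ⋃ i, ball (z i) (R i), g x - o ≠ 0 := fun x hx h1 =>
    (h.mapsTo hx).2 (mem_iUnion.mpr ⟨σ i, by rwa [sub_eq_zero.mp h1]⟩)
  have hgp : ∀ x ∈ (closure Ω \ ⋃ i, ball (z i) (R i)) \ ball p ρ, g x - g p ≠ 0 := fun x hx h1 =>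
    hx.2 (by
      rw [h.injOn hx.1 (sdiff_closedBalls_subset z R hp) (sub_eq_zero.mp h1)]
      exact mem_ball_self hρ)
  obtain ⟨k, hk⟩ := HasWind.exists (h.family.pos i).le
    ((h.continuousOn.mono (h.sphere_subset i)).sub continuousOn_const)
    fun x hx => hgo x (h.sphere_subset i hx)
  have hoΩ : o ∈ Ω' := h.family'.subset _ (ball_subset_closedBall ho)
  obtain ⟨H, hHc, hH⟩ := exists_log_relation h.isOpen' h.isPreconnected'
    (h.mapsTo_interior hp).1 hoΩ
  have hwp : ∀ l, HasWind (fun x => g x - g p) (z l) (R l) 0 := fun l =>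
    h.hasWind_comp (L := fun w => w - g p) (by fun_prop) fun w hw hw0 =>
      notMem_closedBall (h.mapsTo_interior hp) _ (sub_eq_zero.mp hw0 ▸ hw)
  have key := sum_wind_add_eq h.isOpen h.isBounded h.family hρ hball
    (F := fun x => (g x - g p) / (g x - o)) (k := fun l => if l = i then -k else 0) (N := 1)
    (j := 0)
    (h := fun x => H (g x))
    (((h.continuousOn.mono sdiff_subset).sub continuousOn_const).div
      ((h.continuousOn.mono sdiff_subset).sub continuousOn_const) fun x hx => hgo x hx.1)
    (fun x hx => div_ne_zero (hgp x hx) (hgo x hx.1))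
    (fun l => by
      by_cases hl : l = i
      · subst hl
        simpa using (hwp l).div hk
      · rw [if_neg hl]
        simpa using (hwp l).div (h.hasWind_comp (L := fun w => w - o) (by fun_prop)
          fun w hw hw0 => disjoint_left.mp (h.family'.disjoint (h.injective.ne hl))
            (sub_eq_zero.mp hw0 ▸ hw) (ball_subset_closedBall ho)))
    (by
      have h1 := (HasWind.sub_center hρ (c := p)).mul (HasWind.of_closedBall hρ.le
        ((h.continuousOn_dslope hp).mono hballK) fun x hx => h.dslope_ne_zero hp (hballK hx))
      have h2 := HasWind.of_closedBall hρ.le ((h.continuousOn.mono hballK).sub continuousOn_const)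
        fun x hx => hgo x (hballK hx)
      have h3 := (h1.div h2).congr hρ.le (G := fun x => (g x - g p) / (g x - o))
        fun x _ => by rw [sub_eq_mul_dslope g p x]; rfl
      simpa using h3)
    (hHc.comp (h.continuousOn.mono h.frontier_subset) fun x hx => h.mem_frontier hx)
    (fun x hx => by
      rw [zpow_zero, mul_one, hH _ (h.mem_frontier hx)]
      exact mul_div_cancel_right₀ _ (hgo x (h.frontier_subset hx)))
  rw [Finset.sum_ite_eq' Finset.univ i, if_pos (Finset.mem_univ i)] at key
  have : k = 1 := by linarith
  rwa [this] at hk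

end IsCircleDomainMap

/-- On the diagonal of the product of two Jordan curves, a nonvanishing function on the product is
the product of its restrictions to the two factors, up to a continuous exponential. -/
theorem exists_log_diagonal {κ : ℝ → ℂ} (hκ : Continuous κ)
    (hκp : Function.Periodic κ (2 * Real.pi))
    (hinj : ∀ s t, κ s = κ t → ∃ k : ℤ, s = t + k * (2 * Real.pi)) {g : ℂ → ℂ}
    (hg : ContinuousOn g (range κ)) {W : ℂ → ℂ → ℂ} (hW : Continuous fun x : ℂ × ℂ => W x.1 x.2)
    (h0 : ∀ x ∈ range κ, ∀ y ∈ range κ, W x (g y) ≠ 0) :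
    ∃ h : ℂ → ℂ, ContinuousOn h (range κ) ∧ ∃ o ∈ range κ, ∀ x ∈ range κ,
      W x (g x) = Complex.exp (h x) * W x (g o) * W o (g x) := by
  have hgκ : Continuous fun s => g (κ s) := hg.comp_continuous hκ fun s => mem_range_self s
  obtain ⟨H, hHc, hH⟩ := exists_continuous_exp_eq (X := ℝ × ℝ)
    (f := fun x => W (κ x.1) (g (κ x.2)))
    (hW.comp ((hκ.comp continuous_fst).prodMk (hgκ.comp continuous_snd)))
    fun x => h0 _ (mem_range_self _) _ (mem_range_self _)
  obtain ⟨k, hk⟩ := eq_of_exp_eq_one (X := ℝ × ℝ)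
    (f := fun x => H (x.1 + 2 * Real.pi, x.2) - H x) (by fun_prop) fun x => by
      rw [Complex.exp_sub, ← hH, ← hH]
      rw [hκp, div_self (h0 _ (mem_range_self _) _ (mem_range_self _))]
  obtain ⟨l, hl⟩ := eq_of_exp_eq_one (X := ℝ × ℝ)
    (f := fun x => H (x.1, x.2 + 2 * Real.pi) - H x) (by fun_prop) fun x => by
      rw [Complex.exp_sub, ← hH, ← hH]
      rw [hκp, div_self (h0 _ (mem_range_self _) _ (mem_range_self _))]
  obtain ⟨h, hhc, hh⟩ := exists_descent hκ hκp hinj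
    (H := fun s => H (s, s) - H (s, 0) - H (0, s)) (by fun_prop) fun s => by
      have h1 := hk (s, s + 2 * Real.pi)
      have h2 := hl (s, s)
      have h3 := hk (s, 0)
      have h4 := hl (0, s)
      beta_reduce at *
      linear_combination h1 + h2 - h3 - h4
  refine ⟨h, hhc, κ 0, mem_range_self 0, ?_⟩
  rintro x ⟨s, rfl⟩
  have h1 := hH (s, s)
  have h2 := hH (s, 0)
  have h3 := hH (0, s)
  beta_reduce at h1 h2 h3
  rw [hh, h1, h2, h3, ← Complex.exp_add, ← Complex.exp_add]
  congr 1
  ring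

namespace IsCircleDomainMap

variable {ι ι' : Type*} {Ω Ω' : Set ℂ} {z : ι → ℂ} {R : ι → ℝ} {z' : ι' → ℂ}
    {R' : ι' → ℝ} {σ : ι → ι'} {g : ℂ → ℂ}

theorem hasWind_dslope [Finite ι] (h : IsCircleDomainMap Ω Ω' z R z' R' σ g) {p : ℂ}
    (hp : p ∈ Ω \ ⋃ i, closedBall (z i) (R i)) (i : ι) :
    HasWind (dslope g p) (z i) (R i) 0 := by
  have h1 := h.hasWind_comp (i := i) (L := fun w => w - g p) (by fun_prop) fun w hw hw0 =>
      notMem_closedBall (h.mapsTo_interior hp) _ (sub_eq_zero.mp hw0 ▸ hw)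
  have h2 := HasWind.sub_exterior (h.family.pos i).le (notMem_closedBall hp i)
  refine (h1.div h2).congr (h.family.pos i).le fun x hx => ?_
  have hxp : x - p ≠ 0 := fun hxp =>
    notMem_closedBall hp i (sphere_subset_closedBall (sub_eq_zero.mp hxp ▸ hx))
  rw [sub_eq_mul_dslope g p x, mul_div_cancel_left₀ _ hxp]

/-- The Möbius incidence function of a circle domain map has at most two zeros near a point if it
does not vanish on the product of the outer boundaries. -/
theorem wind_le_two [Finite ι] (h : IsCircleDomainMap Ω Ω' z R z' R' σ g) {κ : ℝ → ℂ}
    (hκ : Continuous κ) (hκp : Function.Periodic κ (2 * Real.pi))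
    (hinj : ∀ s t, κ s = κ t → ∃ k : ℤ, s = t + k * (2 * Real.pi)) (hκΩ : range κ = frontier Ω)
    {p : ℂ} {ρ : ℝ} (hρ : 0 < ρ) (hball : closedBall p ρ ⊆ Ω \ ⋃ i, closedBall (z i) (R i))
    {a b c d : ℂ} (hΔ : a * d - b * c ≠ 0)
    (hW : ∀ x ∈ frontier Ω, ∀ w ∈ frontier Ω', c * x * w + d * w - a * x - b ≠ 0)
    (hS : ∀ i, ∀ x ∈ sphere (z i) (R i), c * x * g x + d * g x - a * x - b ≠ 0) {N : ℤ}
    (hN : HasWind (fun x => c * x * g x + d * g x - a * x - b) p ρ N) : N ≤ 2 := by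
  cases nonempty_fintype ι
  have hp := hball (mem_closedBall_self hρ.le)
  have hp' := h.mapsTo_interior hp
  have hballK := hball.trans (sdiff_closedBalls_subset z R)
  have hAo := isOpen_sdiff_closedBalls h.isOpen z R
  obtain ⟨H, hHc, o, ho, hH⟩ := exists_log_diagonal hκ hκp hinj (g := g)
    (W := fun x w => c * x * w + d * w - a * x - b)
    (h.continuousOn.mono (hκΩ ▸ h.frontier_subset)) (by fun_prop)
    (fun x hx y hy => hW x (hκΩ ▸ hx) _ (h.mem_frontier (hκΩ ▸ hy)))
  rw [hκΩ] at hHc hH ho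
  obtain ⟨j₁, D₁, h₁, hj₁, hD₁, hD₁0, hh₁, he₁⟩ := exists_affine_factor h.isOpen h.isPreconnected
    ⟨o, ho⟩ hp.1 (α := c * g o - a) (β := d * g o - b) fun x hx h0 =>
      hW x hx _ (h.mem_frontier ho) (by linear_combination h0)
  obtain ⟨j₂, D₂, h₂, hj₂, hD₂, hD₂0, hh₂, he₂⟩ := exists_affine_factor h.isOpen' h.isPreconnected'
    ⟨g o, h.mem_frontier ho⟩ hp'.1 (α := c * o + d) (β := -(a * o + b)) fun x hx h0 =>
      hW o ho x hx (by linear_combination h0)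
  have hQ0 : ∀ x ∈ closure Ω \ ⋃ i, ball (z i) (R i), dslope g p x ≠ 0 :=
    fun x hx => h.dslope_ne_zero hp hx
  have hden : ∀ x ∈ closure Ω \ ⋃ i, ball (z i) (R i),
      D₁ x * D₂ (g x) * dslope g p x ^ j₂ ≠ 0 := fun x hx =>
    mul_ne_zero (mul_ne_zero (hD₁0 x hx.1) (hD₂0 _ (h.mapsTo hx).1)) (zpow_ne_zero _ (hQ0 x hx))
  choose k hk0 hk using fun i => circle_index (h.family.pos i)
    (h.continuousOn.mono (h.sphere_subset i)) (fun x hx => h.mem_sphere hx)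
    (h.injOn.mono (h.sphere_subset i)) (fun o ho => h.hasWind_sphere ⟨p, hp⟩ ho) hΔ (hS i)
  have hgc := h.continuousOn
  have hgd := h.differentiableOn
  have key := sum_wind_add_le h.isOpen h.isPreconnected h.isBounded h.family hρ hball
    (F := fun x => (c * x * g x + d * g x - a * x - b) / (D₁ x * D₂ (g x) * dslope g p x ^ j₂))
    (k := k) (N := N) (j := j₁ + j₂) (h := fun x => H x + h₁ x + h₂ (g x))
    (ContinuousOn.div (by fun_prop) ((hD₁.continuous.continuousOn.mul
      (hD₂.continuous.comp_continuousOn hgc)).mul ((h.continuousOn_dslope hp).zpow₀ _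
        fun x hx => Or.inl (hQ0 x hx))) hden)
    (DifferentiableOn.div (by fun_prop) ((hD₁.differentiableOn.mul
      (hD₂.comp_differentiableOn hgd)).mul ((h.differentiableOn_dslope hp).zpow
        (Or.inl fun x hx => hQ0 x (sdiff_closedBalls_subset z R hx))))
        fun x hx => hden x (sdiff_closedBalls_subset z R hx))
    (fun i => by
      have e1 := HasWind.of_closedBall (h.family.pos i).le hD₁.continuous.continuousOn
        fun x hx => hD₁0 x (subset_closure (h.family.subset i hx))
      have e2 := h.hasWind_comp (i := i) hD₂.continuous.continuousOn
        fun x hx => hD₂0 x (subset_closure (h.family'.subset _ hx))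
      simpa using (hk i).div ((e1.mul e2).mul ((h.hasWind_dslope hp i).zpow j₂)))
    (by
      have e1 := HasWind.of_closedBall hρ.le hD₁.continuous.continuousOn
        fun x hx => hD₁0 x (hballK hx).1
      have e2 := HasWind.of_closedBall hρ.le
        (hD₂.continuous.comp_continuousOn (hgc.mono hballK))
        fun x hx => hD₂0 _ (h.mapsTo (hballK hx)).1
      have e3 := HasWind.of_closedBall hρ.le ((h.continuousOn_dslope hp).mono hballK)
        fun x hx => hQ0 x (hballK hx)
      simpa using hN.div ((e1.mul e2).mul (e3.zpow j₂)))
    ((hHc.add hh₁).add (hh₂.comp (hgc.mono h.frontier_subset) fun x hx => h.mem_frontier hx))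
    (fun x hx => by
      have hxK := h.frontier_subset hx
      have hxp : x - p ≠ 0 := fun hxp => frontier_notMem h.isOpen hx (sub_eq_zero.mp hxp ▸ hp.1)
      have e1 := he₁ x hx
      have e2 := he₂ (g x) (h.mem_frontier hx)
      rw [div_eq_iff (hden x hxK), hH x hx,
        show c * x * g o + d * g o - a * x - b = (c * g o - a) * x + (d * g o - b) by ring,
        show c * o * g x + d * g x - a * o - b = (c * o + d) * g x + -(a * o + b) by ring,
        e1, e2, sub_eq_mul_dslope g p x, mul_zpow, zpow_add₀ hxp, Complex.exp_add, Complex.exp_add]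
      ring)
  have : 0 ≤ ∑ i, k i := Finset.sum_nonneg fun i _ => hk0 i
  linarith

end IsCircleDomainMap

theorem dimH_range_graph_le {Θ : ℝ → ℝ} (hΘ : Monotone Θ) :
    dimH (range fun s => (s, Θ s)) ≤ 1 := by
  have h1 : AntilipschitzWith 1 fun x : range fun s => (s, Θ s) => x.1.1 + x.1.2 := by
    refine AntilipschitzWith.of_le_mul_dist ?_
    rintro ⟨_, s, rfl⟩ ⟨_, t, rfl⟩
    rw [NNReal.coe_one, one_mul, Subtype.dist_eq, Prod.dist_eq, Real.dist_eq, Real.dist_eq,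
      Real.dist_eq, max_le_iff]
    rcases le_total s t with hst | hst
    · have := hΘ hst
      constructor <;> rw [abs_of_nonpos, abs_of_nonpos] <;> simp only <;> linarith
    · have := hΘ hst
      constructor <;> rw [abs_of_nonneg, abs_of_nonneg] <;> simp only <;> linarith
  have h2 := isometry_subtype_coe.dimH_image (univ : Set (range fun s => (s, Θ s)))
  rw [image_univ, Subtype.range_coe] at h2
  rw [h2, ← Real.dimH_univ]
  exact (h1.le_dimH_image univ).trans (dimH_mono (subset_univ _))

/-- The graph of a homeomorphism between circles has small image under smooth maps. -/
theorem dimH_image_graph_le {g : ℂ → ℂ} {c₀ c₁ : ℂ} {r r₁ : ℝ} (hr : 0 < r) (hr₁ : 0 < r₁)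
    (hm : ∀ x ∈ sphere c₀ r, g x ∈ sphere c₁ r₁) (hinj : InjOn g (sphere c₀ r))
    (hw : HasWind (fun x => g x - c₁) c₀ r 1) {W : ℂ × ℂ → ℂ} (hW : ContDiff ℝ 1 W) :
    dimH ((fun x => W (x, g x)) '' sphere c₀ r) ≤ 1 := by
  have hz : ∀ s, circleMap c₀ r s ∈ sphere c₀ r := circleMap_mem_sphere c₀ hr.le
  have hn : ∀ s, ‖g (circleMap c₀ r s) - c₁‖ = r₁ := fun s => mem_sphere_iff_norm.mp (hm _ (hz s))
  obtain ⟨ρ, Θ, -, -, hρ, -, -, hΘm, hue⟩ := exists_polar hw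
    (fun s t hst => circleMap_eq_imp hr.ne' s t (hinj (hz s) (hz t) (sub_left_injective hst)))
    (fun s t w x y hx hy hs ht => by
      beta_reduce at hs ht
      have h1 := hn s
      have h2 := hn t
      rw [hs, norm_mul, Complex.norm_real, Real.norm_of_nonneg hx.le] at h1
      rw [ht, norm_mul, Complex.norm_real, Real.norm_of_nonneg hy.le] at h2
      refine mul_right_cancel₀ (b := ‖w‖) (fun h0 => ?_) (h1.trans h2.symm)
      rw [h0, mul_zero] at h1
      exact hr₁.ne h1)
  have hg : ∀ s, g (circleMap c₀ r s) = circleMap c₁ r₁ (Θ s) := fun s => by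
    have h1 := hn s
    have h2 := hue s
    beta_reduce at h2
    rw [h2, norm_mul, Complex.norm_exp_ofReal_mul_I, mul_one, Complex.norm_real,
      Real.norm_of_nonneg (hρ s).le] at h1
    rw [h1] at h2
    simp only [circleMap] at h2 ⊢
    linear_combination h2
  set Ψ : ℝ × ℝ → ℂ := fun q => W (circleMap c₀ r q.1, circleMap c₁ r₁ q.2) with hΨ
  have hΨd : ContDiff ℝ 1 Ψ := by
    refine hW.comp (ContDiff.prodMk ?_ ?_)
    · exact (contDiff_circleMap c₀ r).comp contDiff_fst
    · exact (contDiff_circleMap c₁ r₁).comp contDiff_snd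
  have hsub : (fun x => W (x, g x)) '' sphere c₀ r ⊆ Ψ '' range fun s => (s, Θ s) := by
    rintro _ ⟨x, hx, rfl⟩
    rw [← abs_of_pos hr, ← range_circleMap] at hx
    obtain ⟨s, rfl⟩ := hx
    exact ⟨_, ⟨s, rfl⟩, by simp only [hΨ, hg]⟩
  exact (dimH_mono hsub).trans ((hΨd.contDiffOn.dimH_image_le convex_univ
    (subset_univ _)).trans (dimH_range_graph_le hΘm))

theorem isPreconnected_annulus (c : ℂ) {r : ℝ} (hr : 0 ≤ r) (r' : ℝ) :
    IsPreconnected (ball c r' \ closedBall c r) := by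
  have h : ball c r' \ closedBall c r =
      (fun q : ℝ × ℝ => circleMap c q.1 q.2) '' (Ioo r r' ×ˢ univ) := by
    ext x
    rw [Set.mem_sdiff, mem_ball, mem_closedBall, not_le]
    constructor
    · rintro ⟨h1, h2⟩
      refine ⟨(‖x - c‖, (x - c).arg), ⟨?_, mem_univ _⟩, ?_⟩
      · rw [dist_eq_norm] at h1 h2
        exact ⟨h2, h1⟩
      · simp only [circleMap, Complex.norm_mul_exp_arg_mul_I]
        ring
    · rintro ⟨⟨ρ, θ⟩, ⟨h1, -⟩, rfl⟩
      rw [mem_sphere.mp (circleMap_mem_sphere c (hr.trans h1.1.le) θ)]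
      exact ⟨h1.2, h1.1⟩
  rw [h]
  refine (isPreconnected_Ioo.prod isPreconnected_univ).image _ (Continuous.continuousOn ?_)
  simp only [circleMap]
  fun_prop

theorem exists_mem_frontier_closure_connectedComponentIn {ι : Type*} [Finite ι] {Ω : Set ℂ}
    (hΩ : IsOpen Ω) (hb : Bornology.IsBounded Ω) {c : ι → ℂ} {r : ι → ℝ}
    (hfam : IsSchottkyFamily Ω c r) {p : ℂ} (hp : p ∈ Ω \ ⋃ i, closedBall (c i) (r i)) :
    ∃ x ∈ frontier Ω, x ∈ closure (connectedComponentIn (Ω \ ⋃ i, closedBall (c i) (r i)) p) := by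
  have hAo := isOpen_sdiff_closedBalls hΩ c r
  set A := Ω \ ⋃ i, closedBall (c i) (r i) with hA
  set C := connectedComponentIn A p with hC
  have hCA : C ⊆ A := connectedComponentIn_subset A p
  have hCo : IsOpen C := hAo.connectedComponentIn
  have hCb : Bornology.IsBounded C := hb.subset (hCA.trans sdiff_subset)
  obtain ⟨x, hx, hmax⟩ := hCb.isCompact_closure.exists_isMaxOn
    ⟨p, subset_closure (mem_connectedComponentIn hp)⟩ Complex.continuous_re.continuousOn
  have hxC : x ∉ C := fun hxC => by
    obtain ⟨ε, hε, hball⟩ := Metric.isOpen_iff.mp hCo x hxC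
    have h1 : x + (ε / 2 : ℝ) ∈ C := hball (by
      rw [mem_ball_iff_norm, add_sub_cancel_left, Complex.norm_real,
        Real.norm_of_nonneg (half_pos hε).le]
      exact half_lt_self hε)
    have h2 := hmax (subset_closure h1)
    simp only [mem_ofPred_eq, Complex.add_re, Complex.ofReal_re] at h2
    linarith
  have hxA : x ∉ A := notMem_of_mem_frontier_connectedComponentIn (x₀ := p) hAo
    (by rw [hCo.frontier_eq]; exact ⟨hx, hxC⟩)
  have hxK : x ∈ closure Ω \ ⋃ i, ball (c i) (r i) := by
    rw [← closure_sdiff_closedBalls hΩ hfam]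
    exact closure_mono hCA hx
  rcases mem_frontier_or_sphere hΩ hxK hxA with h1 | ⟨i, h1⟩
  · exact ⟨x, h1, hx⟩
  exfalso
  have hV : IsOpen (Ω \ ⋃ j : {j // j ≠ i}, closedBall (c j) (r j)) :=
    isOpen_sdiff_closedBalls hΩ (fun j : {j // j ≠ i} => c j) (fun j => r j)
  obtain ⟨δ, hδ, hδV⟩ := (isCompact_closedBall (c i) (r i)).exists_thickening_subset_open hV
    (fun y hy => ⟨hfam.subset i hy, fun hy' => by
      obtain ⟨⟨j, hji⟩, hj⟩ := mem_iUnion.mp hy'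
      exact disjoint_left.mp (hfam.disjoint hji) hj hy⟩)
  rw [thickening_closedBall hδ (hfam.pos i).le] at hδV
  have hann : ball (c i) (δ + r i) \ closedBall (c i) (r i) ⊆ A := fun y hy => by
    refine ⟨(hδV hy.1).1, fun hy' => ?_⟩
    obtain ⟨j, hj⟩ := mem_iUnion.mp hy'
    by_cases hji : j = i
    · exact hy.2 (hji ▸ hj)
    · exact (hδV hy.1).2 (mem_iUnion.mpr ⟨⟨j, hji⟩, hj⟩)
  obtain ⟨y, hyb, hyC⟩ := mem_closure_iff.mp hx (ball (c i) (δ + r i)) isOpen_ball (by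
    rw [mem_ball, mem_sphere.mp h1]; linarith)
  have hyi : y ∉ closedBall (c i) (r i) := fun hy => (hCA hyC).2 (mem_iUnion.mpr ⟨i, hy⟩)
  have h2 := (isPreconnected_annulus (c i) (hfam.pos i).le (δ + r i)).subset_connectedComponentIn
    ⟨hyb, hyi⟩ hann
  rw [← connectedComponentIn_eq hyC] at h2
  have hn : ‖c i + ((r i + δ / 2 : ℝ) : ℂ) - c i‖ = r i + δ / 2 := by
    have := hfam.pos i
    rw [add_sub_cancel_left, Complex.norm_real, Real.norm_of_nonneg (by positivity)]
  have h3 : c i + ((r i + δ / 2 : ℝ) : ℂ) ∈ C := h2 (by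
    rw [Set.mem_sdiff, mem_ball_iff_norm, mem_closedBall_iff_norm, hn]
    constructor <;> linarith)
  have h4 := hmax (subset_closure h3)
  simp only [mem_ofPred_eq, Complex.add_re, Complex.ofReal_re] at h4
  have h5 := Complex.re_le_norm (x - c i)
  rw [mem_sphere_iff_norm.mp h1, Complex.sub_re] at h5
  linarith

theorem IsJordanDomain.exists_parametrization {Ω : Set ℂ} (hΩ : IsJordanDomain Ω) :
    ∃ κ : ℝ → ℂ, Continuous κ ∧ Function.Periodic κ (2 * Real.pi) ∧
      (∀ s t, κ s = κ t → ∃ k : ℤ, s = t + k * (2 * Real.pi)) ∧ range κ = frontier Ω := by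
  obtain ⟨γ, hγ, hinj, him⟩ := hΩ.2.2.1
  have hz : ∀ s, circleMap 0 1 s ∈ sphere (0 : ℂ) 1 := circleMap_mem_sphere 0 zero_le_one
  refine ⟨fun s => γ (circleMap 0 1 s), hγ.comp_continuous (continuous_circleMap 0 1) hz,
    fun s => congrArg γ (circleMap_add_two_pi 0 1 s),
    fun s t hst => circleMap_eq_imp one_ne_zero s t (hinj (hz s) (hz t) hst), ?_⟩
  have h1 := range_circleMap 0 1
  rw [abs_one] at h1
  rw [← him, ← h1, ← range_comp]
  rfl

theorem IsCompact.exists_pos_le_norm {X : Type*} [TopologicalSpace X] {K : Set X}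
    (hK : IsCompact K) {f : X → ℂ} (hf : ContinuousOn f K) (h0 : ∀ x ∈ K, f x ≠ 0) :
    ∃ δ > 0, ∀ x ∈ K, δ ≤ ‖f x‖ :=
  hK.exists_forall_le' hf.norm fun x hx => norm_pos_iff.mpr (h0 x hx)

/-- If two functions agree to second order, the incidence function vanishes to third order. -/
theorem three_le_analyticOrderAt {g : ℂ → ℂ} {p a b c d : ℂ} (hg : AnalyticAt ℂ g p)
    (hcd : c * p + d ≠ 0) (hm0 : (a * p + b) / (c * p + d) = g p)
    (hm1 : deriv (fun w => (a * w + b) / (c * w + d)) p = deriv g p)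
    (hm2 : deriv (deriv fun w => (a * w + b) / (c * w + d)) p = deriv (deriv g) p) :
    3 ≤ analyticOrderAt (fun x => c * x * g x + d * g x - a * x - b) p := by
  have hnum : AnalyticAt ℂ (fun w => a * w + b) p := by fun_prop
  have hden : AnalyticAt ℂ (fun w => c * w + d) p := by fun_prop
  have hm : AnalyticAt ℂ (fun w => (a * w + b) / (c * w + d)) p := hnum.div hden hcd
  have hG := hg.sub hm
  have h1 : 3 ≤ analyticOrderAt (g - fun w => (a * w + b) / (c * w + d)) p := by
    rw [show (3 : ℕ∞) = ((3 : ℕ) : ℕ∞) from rfl,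
      natCast_le_analyticOrderAt_iff_iteratedDeriv_eq_zero hG]
    have hd : deriv (g - fun w => (a * w + b) / (c * w + d)) =ᶠ[𝓝 p]
        deriv g - deriv fun w => (a * w + b) / (c * w + d) := by
      filter_upwards [hg.eventually_analyticAt, hm.eventually_analyticAt] with x h1 h2
      exact deriv_sub h1.differentiableAt h2.differentiableAt
    intro i hi
    interval_cases i
    · simp [hm0]
    · rw [iteratedDeriv_one, hd.eq_of_nhds]
      simp [hm1]
    · rw [iteratedDeriv_succ, iteratedDeriv_one, hd.deriv_eq,
        deriv_sub hg.deriv.differentiableAt hm.deriv.differentiableAt, hm2, sub_self]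
  have h2 : (fun x => c * x * g x + d * g x - a * x - b) =ᶠ[𝓝 p]
      (fun w => c * w + d) * (g - fun w => (a * w + b) / (c * w + d)) := by
    filter_upwards [hden.continuousAt.eventually_ne hcd] with x hx
    simp only [Pi.mul_apply, Pi.sub_apply]
    rw [mul_sub, mul_div_cancel₀ _ hx]
    ring
  rw [analyticOrderAt_congr h2, analyticOrderAt_mul hden hG]
  exact h1.trans le_add_self

theorem hasWind_of_analyticOrderAt {F : ℂ → ℂ} {A : Set ℂ} (hA : IsOpen A) {p : ℂ} (hp : p ∈ A)
    (hF : DifferentiableOn ℂ F A) {N : ℕ} (hN : analyticOrderAt F p = N) :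
    ∃ ρ > 0, closedBall p ρ ⊆ A ∧ HasWind F p ρ N := by
  obtain ⟨G, hG, hG0, he⟩ := ((hF.analyticOnNhd hA p hp).analyticOrderAt_eq_natCast).mp hN
  have h1 := (hA.eventually_mem hp).and (he.and (hG.eventually_analyticAt.and
    (hG.continuousAt.eventually_ne hG0)))
  obtain ⟨ρ, hρ, hball⟩ := nhds_basis_closedBall.mem_iff.mp h1
  refine ⟨ρ, hρ, fun x hx => (hball hx).1, ?_⟩
  have h2 := ((HasWind.sub_center hρ (c := p)).zpow N).mul (HasWind.of_closedBall hρ.le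
    (fun x hx => (hball hx).2.2.1.continuousAt.continuousWithinAt) fun x hx => (hball hx).2.2.2)
  rw [mul_one, add_zero] at h2
  refine h2.congr hρ.le fun x hx => ?_
  rw [(hball (sphere_subset_closedBall hx)).2.1, zpow_natCast, smul_eq_mul]

theorem IsCircleDomainMap.exists_incidence {ι ι' : Type*} [Finite ι] {Ω Ω' : Set ℂ} {z : ι → ℂ}
    {R : ι → ℝ} {z' : ι' → ℂ} {R' : ι' → ℝ} {σ : ι → ι'} {g : ℂ → ℂ}
    (h : IsCircleDomainMap Ω Ω' z R z' R' σ g) (hΩ : IsJordanDomain Ω)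
    {p : ℂ} (hp : p ∈ Ω \ ⋃ i, closedBall (z i) (R i)) {a b c d : ℂ} (hΔ : a * d - b * c ≠ 0)
    (h3 : 3 ≤ analyticOrderAt (fun x => c * x * g x + d * g x - a * x - b) p) :
    ∃ x ∈ frontier Ω, ∃ w ∈ frontier Ω', c * x * w + d * w - a * x - b = 0 := by
  by_contra! hW
  have hAo := isOpen_sdiff_closedBalls h.isOpen z R
  have hgc := h.continuousOn
  have hgd := h.differentiableOn
  set F : ℂ → ℂ := fun x => c * x * g x + d * g x - a * x - b with hF
  have hFc : ContinuousOn F (closure Ω \ ⋃ i, ball (z i) (R i)) := by fun_prop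
  have hFd : DifferentiableOn ℂ F (Ω \ ⋃ i, closedBall (z i) (R i)) := by fun_prop
  have hK : IsClosed (closure Ω \ ⋃ i, ball (z i) (R i)) :=
    isClosed_closure.sdiff (isOpen_iUnion fun i => isOpen_ball)
  by_cases htop : analyticOrderAt F p = ⊤
  · obtain ⟨x, hx, hxC⟩ := exists_mem_frontier_closure_connectedComponentIn h.isOpen h.isBounded
      h.family hp
    exact hW x hx _ (h.mem_frontier hx) (eq_zero_on_closure_connectedComponentIn hAo hK
      (sdiff_closedBalls_subset z R) hFc hFd hp (analyticOrderAt_eq_top.mp htop) x hxC)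
  obtain ⟨N, hN⟩ := ENat.ne_top_iff_exists.mp htop
  obtain ⟨ρ, hρ, hball, hwind⟩ := hasWind_of_analyticOrderAt hAo hp hFd hN.symm
  have hN3 : 3 ≤ N := by
    rw [← hN] at h3
    exact_mod_cast h3
  have hSK : sphere p ρ ⊆ closure Ω \ ⋃ i, ball (z i) (R i) :=
    sphere_subset_closedBall.trans (hball.trans (sdiff_closedBalls_subset z R))
  obtain ⟨δ₁, hδ₁, hδ₁'⟩ := (isCompact_sphere p ρ).exists_pos_le_norm (hFc.mono hSK)
    fun x hx => hwind.ne_zero hρ hx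
  have hcomp : ∀ {U : Set ℂ}, Bornology.IsBounded U → IsCompact (frontier U) := fun hU =>
    isCompact_of_isClosed_isBounded isClosed_frontier (hU.closure.subset frontier_subset_closure)
  obtain ⟨δ₂, hδ₂, hδ₂'⟩ := ((hcomp h.isBounded).prod (hcomp h.isBounded')).exists_pos_le_norm
    (f := fun q : ℂ × ℂ => c * q.1 * q.2 + d * q.2 - a * q.1 - b) (by fun_prop)
    fun q hq => hW q.1 hq.1 q.2 hq.2
  obtain ⟨δ₃, hδ₃, hδ₃'⟩ : ∃ δ₃ > 0, ∀ ε : ℂ, ‖ε‖ < δ₃ → a * d - (b + ε) * c ≠ 0 := by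
    have h1 : ∀ᶠ ε in 𝓝 (0 : ℂ), a * d - (b + ε) * c ≠ 0 := by
      have h2 : ContinuousAt (fun ε => a * d - (b + ε) * c) 0 := by fun_prop
      exact h2.eventually_ne (by simpa using hΔ)
    obtain ⟨δ, hδ, hδ'⟩ := Metric.eventually_nhds_iff.mp h1
    exact ⟨δ, hδ, fun ε hε => hδ' (by simpa using hε)⟩
  have hdim : dimH (⋃ i, F '' sphere (z i) (R i)) < Module.finrank ℝ ℂ := by
    rw [dimH_iUnion, Complex.finrank_real_complex]
    refine (iSup_le fun i => ?_).trans_lt (b := 1) (by norm_num)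
    exact dimH_image_graph_le (W := fun q : ℂ × ℂ => c * q.1 * q.2 + d * q.2 - a * q.1 - b)
      (h.family.pos i) (h.family'.pos (σ i)) (fun x hx => h.mem_sphere hx)
      (h.injOn.mono (h.sphere_subset i))
      (h.hasWind_sphere ⟨p, hp⟩ (mem_ball_self (h.family'.pos _))) (by fun_prop)
  obtain ⟨ε, hεZ, hε⟩ := (dense_compl_of_dimH_lt_finrank hdim).exists_mem_open
    (isOpen_ball (x := (0 : ℂ)) (ε := min δ₁ (min δ₂ δ₃)))
    ⟨0, mem_ball_self (lt_min hδ₁ (lt_min hδ₂ hδ₃))⟩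
  rw [mem_ball_zero_iff, lt_min_iff, lt_min_iff] at hε
  obtain ⟨κ, hκ, hκp, hκi, hκr⟩ := hΩ.exists_parametrization
  have hle := h.wind_le_two hκ hκp hκi hκr hρ hball (hδ₃' ε hε.2.2)
    (fun x hx w hw h0 => by
      have h1 := hδ₂' (x, w) ⟨hx, hw⟩
      rw [show c * x * w + d * w - a * x - b = ε by linear_combination h0] at h1
      exact hε.2.1.not_ge h1)
    (fun i x hx h0 => hεZ (mem_iUnion.mpr ⟨i, x, hx, by
      simp only [hF]; linear_combination h0⟩)) (N := N)
    (HasWind.of_norm_sub_lt hρ.le hwind ((by fun_prop : ContinuousOn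
        (fun x => c * x * g x + d * g x - a * x - (b + ε)) _).mono hSK) (hFc.mono hSK)
      fun x hx => by
        refine lt_of_lt_of_le ?_ (hδ₁' x hx)
        rw [show c * x * g x + d * g x - a * x - (b + ε) - F x = -ε by simp only [hF]; ring,
          norm_neg]
        exact hε.1)
  have : N ≤ 2 := by exact_mod_cast hle
  omega

/-- If a Möbius transformation `m` agrees with the conformal map `g` of
relative circle domains at a point `p ∈ A` up to second order, then `g(∂Ω)` meets
`m(∂Ω)`. -/
theorem moebius_comparison_boundary_intersection
    (Ω Ωt : Set ℂ) (hΩ : IsJordanDomain Ω) (hΩt : IsJordanDomain Ωt)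
    (n : ℕ) (z : Fin n → ℂ) (R : Fin n → ℝ) (hfam : IsSchottkyFamily Ω z R)
    (A : Set ℂ) (hA : A = Ω \ ⋃ i, closedBall (z i) (R i))
    (m : ℕ) (zt : Fin m → ℂ) (Rt : Fin m → ℝ) (hfamt : IsSchottkyFamily Ωt zt Rt)
    (At : Set ℂ) (hAt : At = Ωt \ ⋃ j, closedBall (zt j) (Rt j))
    (g : ℂ → ℂ) (hg : IsHomeoOn g (closure A) (closure At))
    (hol : DifferentiableOn ℂ g A) (hder : ∀ w ∈ A, deriv g w ≠ 0)
    (hbd : g '' frontier Ω = frontier Ωt)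
    (hper : ∀ i, ∃ j, g '' sphere (z i) (R i) = sphere (zt j) (Rt j))
    (p : ℂ) (hp : p ∈ A)
    (a b c d : ℂ) (hdet : a * d - b * c = 1) (hcd : c * p + d ≠ 0)
    (hm0 : (a * p + b) / (c * p + d) = g p)
    (hm1 : deriv (fun w => (a * w + b) / (c * w + d)) p = deriv g p)
    (hm2 : deriv (deriv fun w => (a * w + b) / (c * w + d)) p = deriv (deriv g) p) :
    ∃ x ∈ frontier Ω, ∃ w ∈ frontier Ω,
      c * w + d ≠ 0 ∧ g x = (a * w + b) / (c * w + d) := by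
  subst hA hAt
  obtain ⟨σ, h⟩ :=
    IsCircleDomainMap.exists_of_isHomeoOn hΩ hΩt hfam hfamt hg hol hder hbd hper
  have han := h.differentiableOn.analyticOnNhd (isOpen_sdiff_closedBalls h.isOpen z R) p hp
  obtain ⟨w, hw, y, hy, h0⟩ := h.exists_incidence hΩ hp (by rw [hdet]; exact one_ne_zero)
    (three_le_analyticOrderAt han hcd hm0 hm1 hm2)
  rw [← hbd] at hy
  obtain ⟨x, hx, rfl⟩ := hy
  have hne : c * w + d ≠ 0 := fun hz => one_ne_zero (α := ℂ) (by
    linear_combination -hdet + (a - c * g x) * hz + c * h0)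
  exact ⟨x, hx, w, hw, hne, (eq_div_iff hne).mpr (by linear_combination h0)⟩
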